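/- arXiv:1804.07267 — 6 statements merged into one kernel-verified Lean document; each statement's English description precedes it below -/
import Mathlib

section
/- For every n ≥ 2, the number of quasi-Stirling permutations of the multiset [n,n] that avoid all of the patterns 123, 213, and 312 equals 2n. -/
/-- `π : Fin (2*n) → Fin n` encodes a permutation of the multiset
`{1,1,2,2,…,n,n}`: every value appears exactly twice. -/
def IsMultisetPerm (n : ℕ) (π : Fin (2 * n) → Fin n) : Prop :=
  ∀ v : Fin n, Nat.card {i : Fin (2 * n) // π i = v} = 2

/-- `π` avoids the pattern 1212. -/
def Avoids1212 (n : ℕ) (π : Fin (2 * n) → Fin n) : Prop :=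
  ¬ ∃ i j k l : Fin (2 * n), i < j ∧ j < k ∧ k < l ∧
      π i = π k ∧ π j = π l ∧ π i < π j

/-- `π` avoids the pattern 2121. -/
def Avoids2121 (n : ℕ) (π : Fin (2 * n) → Fin n) : Prop :=
  ¬ ∃ i j k l : Fin (2 * n), i < j ∧ j < k ∧ k < l ∧
      π i = π k ∧ π j = π l ∧ π j < π i

/-- A quasi-Stirling permutation: a permutation of the multiset `[n,n]`
avoiding both 1212 and 2121. -/
def IsQuasiStirling (n : ℕ) (π : Fin (2 * n) → Fin n) : Prop :=
  IsMultisetPerm n π ∧ Avoids1212 n π ∧ Avoids2121 n π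

/-- `π` contains the length-3 pattern `σ` (with distinct entries):
there are positions `i₁ < i₂ < i₃` whose values are in the same relative
order as `σ`. -/
def Contains3 (n : ℕ) (σ : Fin 3 → ℕ) (π : Fin (2 * n) → Fin n) : Prop :=
  ∃ f : Fin 3 → Fin (2 * n), StrictMono f ∧
    ∀ a b : Fin 3, π (f a) < π (f b) ↔ σ a < σ b

/-- `π` avoids the length-3 pattern `σ`. -/
def Avoids3 (n : ℕ) (σ : Fin 3 → ℕ) (π : Fin (2 * n) → Fin n) : Prop :=
  ¬ Contains3 n σ π

theorem avoids3_iff {n : ℕ} {σ : Fin 3 → ℕ} {π : Fin (2 * n) → Fin n} :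
    Avoids3 n σ π ↔ ∀ i j k : Fin (2 * n), i < j → j < k →
      ¬ ∀ a b : Fin 3, π (![i, j, k] a) < π (![i, j, k] b) ↔ σ a < σ b := by
  constructor
  · intro h i j k hij hjk H
    refine h ⟨![i, j, k], ?_, H⟩
    rw [Fin.strictMono_iff_lt_succ]
    intro a
    fin_cases a
    · exact hij
    · exact hjk
  · rintro h ⟨f, hf, H⟩
    refine h (f 0) (f 1) (f 2) (hf (by decide)) (hf (by decide)) ?_
    have : ![f 0, f 1, f 2] = f := by
      ext a
      fin_cases a <;> rfl
    rwa [this]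

theorem avoids123_iff {n : ℕ} {π : Fin (2 * n) → Fin n} :
    Avoids3 n ![1, 2, 3] π ↔ ∀ i j k : Fin (2 * n), i < j → j < k →
      ¬ (π i < π j ∧ π j < π k) := by
  rw [avoids3_iff]
  refine forall₅_congr fun i j k _ _ => not_congr ?_
  simp only [Fin.forall_fin_succ, Fin.lt_def]
  simp
  omega

theorem avoids213_iff {n : ℕ} {π : Fin (2 * n) → Fin n} :
    Avoids3 n ![2, 1, 3] π ↔ ∀ i j k : Fin (2 * n), i < j → j < k →
      ¬ (π j < π i ∧ π i < π k) := by
  rw [avoids3_iff]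
  refine forall₅_congr fun i j k _ _ => not_congr ?_
  simp only [Fin.forall_fin_succ, Fin.lt_def]
  simp
  omega

theorem avoids312_iff {n : ℕ} {π : Fin (2 * n) → Fin n} :
    Avoids3 n ![3, 1, 2] π ↔ ∀ i j k : Fin (2 * n), i < j → j < k →
      ¬ (π j < π k ∧ π k < π i) := by
  rw [avoids3_iff]
  refine forall₅_congr fun i j k _ _ => not_congr ?_
  simp only [Fin.forall_fin_succ, Fin.lt_def]
  simp
  omega

/-- The quasi-Stirling permutations counted by the theorem. -/
def IsAdmissible (n : ℕ) (π : Fin (2 * n) → Fin n) : Prop :=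
  IsQuasiStirling n π ∧ Avoids3 n ![1, 2, 3] π ∧ Avoids3 n ![2, 1, 3] π ∧ Avoids3 n ![3, 1, 2] π

theorem Finset.mem_iff_lt_card_of_isLowerSet {m : ℕ} {S : Finset (Fin m)}
    (hS : ∀ i j, i < j → j ∈ S → i ∈ S) (j : Fin m) : j ∈ S ↔ (j : ℕ) < S.card := by
  constructor
  · intro hj
    have h : Finset.Iic j ⊆ S := fun i hi => by
      rcases (Finset.mem_Iic.1 hi).lt_or_eq with h | rfl
      · exact hS i j h hj
      · exact hj
    simpa using Finset.card_le_card h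
  · contrapose!
    intro hj
    have h : S ⊆ Finset.Iio j := fun i hi => by
      rw [Finset.mem_Iio]
      by_contra! hij
      rcases hij.lt_or_eq with h | rfl
      · exact hj (hS j i h hi)
      · exact hj hi
    simpa using Finset.card_le_card h

namespace IsMultisetPerm

variable {n : ℕ} {π : Fin (2 * n) → Fin n}

theorem card_filter_eq (h : IsMultisetPerm n π) (v : Fin n) :
    (Finset.univ.filter fun i => π i = v).card = 2 := by
  have := h v
  rwa [Nat.card_eq_fintype_card, Fintype.card_subtype] at this

theorem exists_eq (h : IsMultisetPerm n π) (v : Fin n) : ∃ i, π i = v := by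
  have : (Finset.univ.filter fun i => π i = v).Nonempty := by
    rw [← Finset.card_pos, h.card_filter_eq]
    norm_num
  obtain ⟨i, hi⟩ := this
  exact ⟨i, by simpa using hi⟩

theorem not_three (h : IsMultisetPerm n π) {i j k : Fin (2 * n)} (hij : i ≠ j) (hjk : j ≠ k)
    (hik : i ≠ k) (h₁ : π j = π i) (h₂ : π k = π i) : False := by
  have hsub : {i, j, k} ⊆ Finset.univ.filter fun x => π x = π i := by
    intro x
    simp only [Finset.mem_insert, Finset.mem_singleton, Finset.mem_filter_univ]
    rintro (rfl | rfl | rfl)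
    exacts [rfl, h₁, h₂]
  have := Finset.card_le_card hsub
  rw [h.card_filter_eq, Finset.card_eq_three.2 ⟨i, j, k, hij, hik, hjk, rfl⟩] at this
  omega

theorem card_filter_ge (h : IsMultisetPerm n π) (v : Fin n) :
    (Finset.univ.filter fun i => v ≤ π i).card = 2 * (n - v) := by
  rw [Finset.card_eq_sum_card_fiberwise (t := Finset.Ici v) (f := π) (fun i hi => by simpa using hi),
    Finset.sum_congr rfl (g := fun _ => 2), Finset.sum_const, Fin.card_Ici, smul_eq_mul, mul_comm]
  intro w hw
  refine Eq.trans (congrArg Finset.card ?_) (h.card_filter_eq w)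
  rw [Finset.filter_filter]
  ext i
  simp only [Finset.mem_filter_univ, Finset.mem_Ici] at hw ⊢
  constructor
  · exact fun h => h.2
  · rintro rfl
    exact ⟨hw, rfl⟩

theorem of_pairs (p q : Fin n → Fin (2 * n)) (hpq : ∀ v, p v ≠ q v)
    (h : ∀ v i, π i = v ↔ i = p v ∨ i = q v) : IsMultisetPerm n π := by
  intro v
  rw [Nat.card_eq_fintype_card, Fintype.card_subtype]
  refine Eq.trans (congrArg Finset.card ?_) (Finset.card_pair (hpq v))
  ext i
  simp [h]

end IsMultisetPerm

namespace IsAdmissible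

variable {n : ℕ} {π : Fin (2 * n) → Fin n}

theorem isMultisetPerm (h : IsAdmissible n π) : IsMultisetPerm n π := h.1.1

theorem not_cross (h : IsAdmissible n π) {i j k l : Fin (2 * n)} (hij : i < j) (hjk : j < k)
    (hkl : k < l) (hik : π i = π k) (hjl : π j = π l) : π i = π j := by
  rcases lt_trichotomy (π i) (π j) with hlt | heq | hgt
  · exact (h.1.2.1 ⟨i, j, k, l, hij, hjk, hkl, hik, hjl, hlt⟩).elim
  · exact heq
  · exact (h.1.2.2 ⟨i, j, k, l, hij, hjk, hkl, hik, hjl, hgt⟩).elim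

/-- Away from the first letter's value, the remaining word is weakly decreasing. -/
theorem not_lt (h : IsAdmissible n π) {o i j : Fin (2 * n)} (hoi : o < i) (hij : i < j)
    (hi : π i ≠ π o) (hj : π j ≠ π o) : ¬ π i < π j := by
  intro hlt
  have h₁ := avoids123_iff.1 h.2.1 o i j hoi hij
  have h₂ := avoids213_iff.1 h.2.2.1 o i j hoi hij
  have h₃ := avoids312_iff.1 h.2.2.2 o i j hoi hij
  simp only [Fin.lt_def, ne_eq, Fin.ext_iff] at *
  omega

theorem mem_iff_of_eq (h : IsAdmissible n π) {o e : Fin (2 * n)} (ho : (o : ℕ) = 0)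
    (he : (e : ℕ) = 1) (hoe : π e = π o) (v : Fin n) (j : Fin (2 * n)) :
    (j = o ∨ j = e) ∨ v ≤ π j ↔
      (j : ℕ) < 2 * (n - v) + if π o < v then 2 else 0 := by
  have hne : o ≠ e := fun hh => by rw [hh] at ho; omega
  have hlow := Finset.mem_iff_lt_card_of_isLowerSet
    (S := {o, e} ∪ Finset.univ.filter fun i => v ≤ π i) (fun i j hij => by
      simp only [Finset.mem_union, Finset.mem_insert, Finset.mem_singleton, Finset.mem_filter_univ]
      intro hj
      by_contra! hi
      obtain ⟨⟨hio, hie⟩, hi⟩ := hi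
      have hoi : o < i := by simp only [Fin.lt_def, ne_eq, Fin.ext_iff] at *; omega
      have hj' : j ≠ o ∧ j ≠ e := by simp only [Fin.lt_def, ne_eq, Fin.ext_iff] at *; omega
      have hvj : v ≤ π j := by tauto
      exact h.not_lt hoi hij
        (fun hh => h.isMultisetPerm.not_three hne hie.symm hio.symm hoe hh)
        (fun hh => h.isMultisetPerm.not_three hne hj'.2.symm hj'.1.symm hoe hh)
        (hi.trans_le hvj)) j
  simp only [Finset.mem_union, Finset.mem_insert, Finset.mem_singleton,
    Finset.mem_filter_univ] at hlow
  rw [hlow]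
  split_ifs with hv
  · rw [Finset.card_union_of_disjoint, h.isMultisetPerm.card_filter_ge, Finset.card_pair hne,
      add_comm]
    rw [Finset.disjoint_left]
    simp [hoe, hv]
  · rw [Finset.union_eq_right.2, h.isMultisetPerm.card_filter_ge, add_zero]
    intro i
    simp only [Finset.mem_insert, Finset.mem_singleton, Finset.mem_filter_univ]
    rintro (rfl | rfl)
    · exact le_of_not_gt hv
    · rw [hoe]
      exact le_of_not_gt hv

theorem mem_iff_of_ne (h : IsAdmissible n π) {o e : Fin (2 * n)} (ho : (o : ℕ) = 0)
    (he : (e : ℕ) = 1) (hoe : π e ≠ π o) (hmax : ∃ c, π o < c) (v : Fin n) (j : Fin (2 * n)) :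
    j = o ∨ v ≤ π j ↔ (j : ℕ) < 2 * (n - v) + if π o < v then 1 else 0 := by
  have hlow := Finset.mem_iff_lt_card_of_isLowerSet
    (S := {o} ∪ Finset.univ.filter fun i => v ≤ π i) (fun i j hij => by
      simp only [Finset.mem_union, Finset.mem_singleton, Finset.mem_filter_univ]
      intro hj
      by_contra! hi
      obtain ⟨hio, hi⟩ := hi
      have hoi : o < i := by simp only [Fin.lt_def, ne_eq, Fin.ext_iff] at *; omega
      have hj' : j ≠ o := (hoi.trans hij).ne'
      have hvj : v ≤ π j := by tauto
      have hlt := hi.trans_le hvj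
      have hoe' : o < e := by rw [Fin.lt_def]; omega
      by_cases hio : π i = π o
      · have hei : e < i := by
          refine lt_of_le_of_ne (by rw [Fin.le_def]; rw [Fin.lt_def] at hoi; omega) ?_
          rintro rfl
          exact hoe hio
        have hjo : π j ≠ π o := by rw [← hio]; exact hlt.ne'
        rcases lt_trichotomy (π e) (π j) with h₁ | h₁ | h₁
        · exact h.not_lt hoe' (hei.trans hij) hoe hjo h₁
        · exact hoe (h.not_cross hoe' hei hij hio.symm h₁).symm
        · exact avoids312_iff.1 h.2.2.2 e i j hei hij ⟨hlt, h₁⟩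
      · by_cases hjo : π j = π o
        · obtain ⟨c, hc⟩ := hmax
          obtain ⟨q, rfl⟩ := h.isMultisetPerm.exists_eq c
          rcases lt_trichotomy q i with h₁ | rfl | h₁
          · exact avoids312_iff.1 h.2.2.2 q i j h₁ hij ⟨hlt, hjo ▸ hc⟩
          · exact (hlt.trans (hjo ▸ hc)).false
          · exact h.not_lt hoi h₁ hio hc.ne' (hlt.trans (hjo ▸ hc))
        · exact h.not_lt hoi hij hio hjo hlt) j
  simp only [Finset.mem_union, Finset.mem_singleton, Finset.mem_filter_univ] at hlow
  rw [hlow]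
  split_ifs with hv
  · rw [Finset.card_union_of_disjoint, h.isMultisetPerm.card_filter_ge, Finset.card_singleton,
      add_comm]
    rw [Finset.disjoint_left]
    simp [hv]
  · rw [Finset.union_eq_right.2, h.isMultisetPerm.card_filter_ge, add_zero]
    intro i
    simp only [Finset.mem_singleton, Finset.mem_filter_univ]
    rintro rfl
    exact le_of_not_gt hv

theorem second_of_max (h : IsAdmissible n π) {o e : Fin (2 * n)} (ho : (o : ℕ) = 0)
    (he : (e : ℕ) = 1) (hoe : π e ≠ π o) (hmax : (π o : ℕ) = n - 1) : (π e : ℕ) = n - 2 := by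
  by_contra hne
  have hen := (π e).isLt
  have hoe' : (π e : ℕ) ≠ π o := fun hh => hoe (Fin.ext hh)
  obtain ⟨q, hq⟩ := h.isMultisetPerm.exists_eq ⟨n - 2, by omega⟩
  rw [Fin.ext_iff] at hq
  simp only at hq
  have hqo : q ≠ o := by rintro rfl; omega
  have hqe : q ≠ e := by rintro rfl; exact hne hq
  refine h.not_lt (o := o) (i := e) (j := q) ?_ ?_ hoe ?_ ?_
  all_goals simp only [Fin.lt_def, ne_eq, Fin.ext_iff] at *; omega

theorem mem_iff_of_max (h : IsAdmissible n π) {o e : Fin (2 * n)} (ho : (o : ℕ) = 0)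
    (he : (e : ℕ) = 1) (hoe : π e ≠ π o) (hmax : (π o : ℕ) = n - 1) (v : Fin n)
    (hv : (v : ℕ) ≤ n - 2) (j : Fin (2 * n)) : v ≤ π j ↔ (j : ℕ) < 2 * (n - v) := by
  have hsec := h.second_of_max ho he hoe hmax
  have hlow := Finset.mem_iff_lt_card_of_isLowerSet
    (S := Finset.univ.filter fun i => v ≤ π i) (fun i j hij => by
      simp only [Finset.mem_filter_univ]
      intro hvj
      by_contra! hi
      have hlt := hi.trans_le hvj
      have hio : i ≠ o := by
        rintro rfl
        rw [Fin.lt_def] at hi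
        omega
      have hie : i ≠ e := by
        rintro rfl
        rw [Fin.lt_def] at hi
        omega
      have hoi : o < i := by simp only [Fin.lt_def, ne_eq, Fin.ext_iff] at *; omega
      have hei : e < i := by simp only [Fin.lt_def, ne_eq, Fin.ext_iff] at *; omega
      have h₁ := h.not_lt hoi hij
      have h₂ := avoids213_iff.1 h.2.2.1 e i j hei hij
      simp only [Fin.lt_def, Fin.le_def, ne_eq, Fin.ext_iff] at *
      omega) j
  rw [← h.isMultisetPerm.card_filter_ge, ← hlow, Finset.mem_filter_univ]

theorem fourth_of_max (h : IsAdmissible n π) {o e : Fin (2 * n)} (ho : (o : ℕ) = 0)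
    (he : (e : ℕ) = 1) (hoe : π e ≠ π o) (hmax : (π o : ℕ) = n - 1) (j : Fin (2 * n))
    (hj : (j : ℕ) < 4) :
    (π j : ℕ) = if (j : ℕ) = 0 ∨ (j : ℕ) = 3 then n - 1 else n - 2 := by
  have hsec := h.second_of_max ho he hoe hmax
  have hn : 2 ≤ n := by
    have := (π e).isLt
    have : (π e : ℕ) ≠ π o := fun hh => hoe (Fin.ext hh)
    omega
  have hmem (k : Fin (2 * n)) (hk : (k : ℕ) < 4) : n - 2 ≤ (π k : ℕ) := by
    have := (h.mem_iff_of_max ho he hoe hmax ⟨n - 2, by omega⟩ le_rfl k).2 (by simp only; omega)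
    simpa [Fin.le_def] using this
  obtain ⟨s, hs⟩ : ∃ s : Fin (2 * n), (s : ℕ) = 2 := ⟨⟨2, by omega⟩, rfl⟩
  obtain ⟨t, ht⟩ : ∃ t : Fin (2 * n), (t : ℕ) = 3 := ⟨⟨3, by omega⟩, rfl⟩
  have hms := hmem s (by omega)
  have hmt := hmem t (by omega)
  have hls := (π s).isLt
  have hlt := (π t).isLt
  have h₁ := h.isMultisetPerm.not_three (i := o) (j := s) (k := t)
  have h₂ := h.isMultisetPerm.not_three (i := e) (j := s) (k := t)
  have h₃ := h.not_cross (i := o) (j := e) (k := s) (l := t)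
  have hj' : j = o ∨ j = e ∨ j = s ∨ j = t := by simp only [Fin.ext_iff]; omega
  simp only [Fin.lt_def, ne_eq, Fin.ext_iff, imp_false] at h₁ h₂ h₃ hoe
  split_ifs
  all_goals
    rcases hj' with rfl | rfl | rfl | rfl <;> omega

theorem eq_of_first_eq {π' : Fin (2 * n) → Fin n} (h : IsAdmissible n π) (h' : IsAdmissible n π')
    {o e : Fin (2 * n)} (ho : (o : ℕ) = 0) (he : (e : ℕ) = 1) (hfirst : π o = π' o)
    (hsecond : π e = π o ↔ π' e = π' o) : π = π' := by
  have key (j : Fin (2 * n)) (H : ∀ v, v ≤ π j ↔ v ≤ π' j) : π j = π' j :=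
    le_antisymm ((H _).1 le_rfl) ((H _).2 le_rfl)
  funext j
  by_cases hoe : π e = π o
  · have hoe' := hsecond.1 hoe
    by_cases hj : j = o ∨ j = e
    · rcases hj with rfl | rfl
      · exact hfirst
      · rw [hoe, hoe', hfirst]
    · refine key j fun v => ?_
      have h₁ := h.mem_iff_of_eq ho he hoe v j
      have h₂ := h'.mem_iff_of_eq ho he hoe' v j
      rw [hfirst, ← h₂] at h₁
      simpa [hj] using h₁
  · have hoe' := fun hh => hoe (hsecond.2 hh)
    by_cases hmax : ∃ c, π o < c
    · by_cases hj : j = o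
      · rw [hj, hfirst]
      · refine key j fun v => ?_
        have h₁ := h.mem_iff_of_ne ho he hoe hmax v j
        have h₂ := h'.mem_iff_of_ne ho he hoe' (hfirst ▸ hmax) v j
        rw [hfirst, ← h₂] at h₁
        simpa [hj] using h₁
    · have hmax : (π o : ℕ) = n - 1 := by
        by_contra hne
        have := (π o).isLt
        exact hmax ⟨⟨n - 1, by omega⟩, by rw [Fin.lt_def]; simp only; omega⟩
      have hmax' : (π' o : ℕ) = n - 1 := hfirst ▸ hmax
      by_cases hj : (j : ℕ) < 4
      · apply Fin.ext
        rw [h.fourth_of_max ho he hoe hmax j hj, h'.fourth_of_max ho he hoe' hmax' j hj]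
      · have hn : 2 ≤ n := by omega
        have h₁ := h.mem_iff_of_max ho he hoe hmax
        have h₂ := h'.mem_iff_of_max ho he hoe' hmax'
        refine key j fun v => ?_
        by_cases hv : (v : ℕ) ≤ n - 2
        · rw [h₁ v hv, h₂ v hv]
        · have h₃ := h₁ ⟨n - 2, by omega⟩ le_rfl j
          have h₄ := h₂ ⟨n - 2, by omega⟩ le_rfl j
          simp only [Fin.le_def] at *
          omega

theorem of_val (hperm : IsMultisetPerm n π)
    (hcross : ∀ i j k l : Fin (2 * n), (i : ℕ) < j → (j : ℕ) < k → (k : ℕ) < l →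
      (π i : ℕ) = π k → (π j : ℕ) = π l → (π i : ℕ) = π j)
    (htriple : ∀ i j k : Fin (2 * n), (i : ℕ) < j → (j : ℕ) < k →
      ¬ ((π i : ℕ) < π j ∧ (π j : ℕ) < π k) ∧ ¬ ((π j : ℕ) < π i ∧ (π i : ℕ) < π k) ∧
        ¬ ((π j : ℕ) < π k ∧ (π k : ℕ) < π i)) : IsAdmissible n π := by
  refine ⟨⟨hperm, ?_, ?_⟩, ?_, ?_, ?_⟩
  · rintro ⟨i, j, k, l, hij, hjk, hkl, hik, hjl, hlt⟩
    exact hlt.ne (Fin.ext (hcross i j k l hij hjk hkl (congrArg _ hik) (congrArg _ hjl)))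
  · rintro ⟨i, j, k, l, hij, hjk, hkl, hik, hjl, hlt⟩
    exact hlt.ne' (Fin.ext (hcross i j k l hij hjk hkl (congrArg _ hik) (congrArg _ hjl)))
  · exact avoids123_iff.2 fun i j k hij hjk => (htriple i j k hij hjk).1
  · exact avoids213_iff.2 fun i j k hij hjk => (htriple i j k hij hjk).2.1
  · exact avoids312_iff.2 fun i j k hij hjk => (htriple i j k hij hjk).2.2

end IsAdmissible

/-- The decreasing word with both copies of `a` moved to the front. -/
def frontPairWord (n : ℕ) (a : Fin n) (i : Fin (2 * n)) : Fin n :=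
  ⟨if (i : ℕ) < 2 then a else if (i : ℕ) / 2 + a < n then n - i / 2 else n - 1 - i / 2, by
    have := a.isLt
    split_ifs <;> omega⟩

/-- The decreasing word with one copy of `a` moved to the front. -/
def frontWord (n : ℕ) (a : Fin n) (i : Fin (2 * n)) : Fin n :=
  ⟨if (i : ℕ) = 0 then a else
    if (i : ℕ) ≤ 2 * (n - 1 - a) then n - 1 - (i - 1) / 2 else n - 1 - i / 2, by
    have := a.isLt
    split_ifs <;> omega⟩

/-- The decreasing word whose first four letters are rearranged so that both copies of the largest
value surround those of the second largest. -/
def nestedWord (n : ℕ) (i : Fin (2 * n)) : Fin n :=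
  ⟨if (i : ℕ) = 0 ∨ (i : ℕ) = 3 then n - 1 else if (i : ℕ) < 3 then n - 2 else n - 1 - i / 2, by
    have := i.isLt
    split_ifs <;> omega⟩

theorem isAdmissible_frontPairWord {n : ℕ} (a : Fin n) : IsAdmissible n (frontPairWord n a) := by
  have ha := a.isLt
  refine .of_val (.of_pairs
    (fun v => ⟨if v = a then 0 else if a < v then 2 * (n - v) else 2 * (n - 1 - v), ?_⟩)
    (fun v => ⟨if v = a then 1 else if a < v then 2 * (n - v) + 1 else 2 * (n - 1 - v) + 1, ?_⟩)
    ?_ ?_) ?_ ?_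
  · have := v.isLt
    simp only [Fin.ext_iff, Fin.lt_def]
    split_ifs <;> omega
  · have := v.isLt
    simp only [Fin.ext_iff, Fin.lt_def]
    split_ifs <;> omega
  · intro v hv
    simp only [Fin.ext_iff, Fin.lt_def] at hv
    split_ifs at hv <;> omega
  · intro v i
    have := v.isLt
    have := i.isLt
    simp only [Fin.ext_iff, Fin.lt_def, frontPairWord]
    split_ifs <;> omega
  · intro i j k l
    have := l.isLt
    simp only [frontPairWord]
    split_ifs <;> omega
  · intro i j k
    have := k.isLt
    simp only [frontPairWord]
    split_ifs <;> omega

theorem isAdmissible_frontWord {n : ℕ} (a : Fin n) : IsAdmissible n (frontWord n a) := by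
  have ha := a.isLt
  refine .of_val (.of_pairs
    (fun v => ⟨if v = a then 0 else if a < v then 2 * (n - 1 - v) + 1 else 2 * (n - 1 - v), ?_⟩)
    (fun v => ⟨if a < v then 2 * (n - 1 - v) + 2 else 2 * (n - 1 - v) + 1, ?_⟩)
    ?_ ?_) ?_ ?_
  · have := v.isLt
    simp only [Fin.ext_iff, Fin.lt_def]
    split_ifs <;> omega
  · have := v.isLt
    simp only [Fin.lt_def]
    split_ifs <;> omega
  · intro v hv
    simp only [Fin.ext_iff, Fin.lt_def] at hv
    split_ifs at hv <;> omega
  · intro v i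
    have := v.isLt
    have := i.isLt
    simp only [Fin.ext_iff, Fin.lt_def, frontWord]
    split_ifs <;> omega
  · intro i j k l
    have := l.isLt
    simp only [frontWord]
    split_ifs <;> omega
  · intro i j k
    have := k.isLt
    simp only [frontWord]
    split_ifs <;> omega

theorem isAdmissible_nestedWord {n : ℕ} (hn : 2 ≤ n) : IsAdmissible n (nestedWord n) := by
  refine .of_val (.of_pairs
    (fun v => ⟨if (v : ℕ) = n - 1 then 0 else if (v : ℕ) = n - 2 then 1 else 2 * (n - 1 - v), ?_⟩)
    (fun v => ⟨if (v : ℕ) = n - 1 then 3 else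
      if (v : ℕ) = n - 2 then 2 else 2 * (n - 1 - v) + 1, ?_⟩)
    ?_ ?_) ?_ ?_
  · have := v.isLt
    split_ifs <;> omega
  · have := v.isLt
    split_ifs <;> omega
  · intro v hv
    simp only [Fin.ext_iff] at hv
    split_ifs at hv <;> omega
  · intro v i
    have := v.isLt
    have := i.isLt
    simp only [Fin.ext_iff, nestedWord]
    split_ifs <;> omega
  · intro i j k l
    have := l.isLt
    simp only [nestedWord]
    split_ifs <;> omega
  · intro i j k
    have := k.isLt
    simp only [nestedWord]
    split_ifs <;> omega

theorem exists_isAdmissible {n : ℕ} (hn : 2 ≤ n) {o e : Fin (2 * n)} (ho : (o : ℕ) = 0)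
    (he : (e : ℕ) = 1) (a : Fin n) (b : Bool) :
    ∃ π, IsAdmissible n π ∧ π o = a ∧ decide (π e = π o) = b := by
  have ha := a.isLt
  cases b
  · by_cases hmax : (a : ℕ) < n - 1
    · refine ⟨frontWord n a, isAdmissible_frontWord a, ?_, ?_⟩
      · simp [frontWord, ho]
      · simp [frontWord, ho, he, Fin.ext_iff]
        omega
    · refine ⟨nestedWord n, isAdmissible_nestedWord hn, ?_, ?_⟩
      · simp [nestedWord, ho, Fin.ext_iff]
        omega
      · simp [nestedWord, ho, he, Fin.ext_iff]
        omega
  · refine ⟨frontPairWord n a, isAdmissible_frontPairWord a, ?_, ?_⟩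
    · simp [frontPairWord, ho]
    · simp [frontPairWord, ho, he]

theorem quasiStirling_avoiding_123_213_312 (n : ℕ) (hn : 2 ≤ n) :
    Nat.card {π : Fin (2 * n) → Fin n //
      IsQuasiStirling n π ∧ Avoids3 n ![1, 2, 3] π ∧ Avoids3 n ![2, 1, 3] π ∧
        Avoids3 n ![3, 1, 2] π} = 2 * n := by
  let o : Fin (2 * n) := ⟨0, by omega⟩
  let e : Fin (2 * n) := ⟨1, by omega⟩
  let code (π : {π : Fin (2 * n) → Fin n // IsAdmissible n π}) : Fin n × Bool :=
    (π.1 o, decide (π.1 e = π.1 o))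
  have hcode : code.Bijective := by
    constructor
    · rintro ⟨π, h⟩ ⟨π', h'⟩ heq
      obtain ⟨hfirst, hsecond⟩ := Prod.ext_iff.1 heq
      exact Subtype.ext (h.eq_of_first_eq h' rfl rfl hfirst (decide_eq_decide.1 hsecond))
    · rintro ⟨a, b⟩
      obtain ⟨π, h, hfirst, hsecond⟩ :=
        exists_isAdmissible hn (o := o) (e := e) rfl rfl a b
      exact ⟨⟨π, h⟩, Prod.ext hfirst hsecond⟩
  have hcard := Nat.card_eq_of_bijective code hcode
  rw [Nat.card_prod, Nat.card_fin, Nat.card_eq_fintype_card (α := Bool), Fintype.card_bool] at hcard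
  exact hcard.trans (mul_comm n 2)
end

section
/- For every n ≥ 2, the number of quasi-Stirling permutations of the multiset [n,n] that avoid all of the patterns 132, 213, and 312 equals 2n. -/
open List

/-- The increasing word `m, m, m + 1, m + 1, …` on `d` letters, each doubled. -/
def doubledRange (m : ℕ) : ℕ → List ℕ
  | 0 => []
  | d + 1 => m :: m :: doubledRange (m + 1) d

theorem mem_doubledRange {m d v : ℕ} : v ∈ doubledRange m d ↔ m ≤ v ∧ v < m + d := by
  induction d generalizing m with
  | zero => simp [doubledRange]
  | succ d ih => simp only [doubledRange, mem_cons, ih]; omega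

theorem count_doubledRange (m d v : ℕ) :
    (doubledRange m d).count v = if m ≤ v ∧ v < m + d then 2 else 0 := by
  induction d generalizing m with
  | zero => simp [doubledRange]
  | succ d ih =>
    simp only [doubledRange, count_cons, ih, beq_iff_eq]
    split_ifs <;> omega

theorem length_doubledRange (m d : ℕ) : (doubledRange m d).length = 2 * d := by
  induction d generalizing m with
  | zero => rfl
  | succ d ih => simp only [doubledRange, length_cons, ih]; ring

theorem pairwise_doubledRange (m d : ℕ) : (doubledRange m d).Pairwise (· ≤ ·) := by
  induction d generalizing m with
  | zero => exact Pairwise.nil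
  | succ d ih =>
    simp only [doubledRange, pairwise_cons, mem_cons, mem_doubledRange]
    refine ⟨?_, ?_, ih _⟩ <;> intro a <;> omega

/-- A word avoiding `1212` and `2121` and the patterns `132`, `213` and `312`. -/
structure AvoidingWord (l : List ℕ) : Prop where
  avoids_three : ∀ a b c, [a, b, c] <+ l →
    ¬(a < c ∧ c < b) ∧ ¬(b < a ∧ a < c) ∧ ¬(b < c ∧ c < a)
  avoids_crossing : ∀ a b, [a, b, a, b] <+ l → a = b

theorem AvoidingWord.of_sublist {l l' : List ℕ} (h : AvoidingWord l) (hl : l' <+ l) :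
    AvoidingWord l' :=
  ⟨fun a b c hs => h.avoids_three a b c (hs.trans hl),
    fun a b hs => h.avoids_crossing a b (hs.trans hl)⟩

theorem AvoidingWord.of_pairwise_le {l : List ℕ} (h : l.Pairwise (· ≤ ·)) : AvoidingWord l := by
  constructor
  · intro a b c hs
    have := h.sublist hs
    simp at this
    omega
  · intro a b hs
    have := h.sublist hs
    simp at this
    omega

theorem append_singleton_sublist_append_singleton {α : Type*} {s l : List α} {c m : α} :
    s ++ [c] <+ l ++ [m] ↔ s ++ [c] <+ l ∨ c = m ∧ s <+ l := by
  rw [← reverse_sublist, ← reverse_sublist (l₁ := s ++ [c]), ← reverse_sublist (l₁ := s)]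
  simp only [reverse_append, reverse_singleton, singleton_append]
  exact cons_sublist_cons'

theorem AvoidingWord.append_min {l : List ℕ} {m : ℕ} (h : AvoidingWord l)
    (hm : ∀ x ∈ l, m ≤ x) (hs : ∀ a, [a, m, a] <+ l → a = m) : AvoidingWord (l ++ [m]) := by
  constructor
  · intro a b c habc
    rcases append_singleton_sublist_append_singleton (s := [a, b]).1 habc with h1 | ⟨rfl, h1⟩
    · exact h.avoids_three a b c h1
    · have ha := hm a (h1.subset (by simp))
      have hb := hm b (h1.subset (by simp))
      omega
  · intro a b hab
    rcases append_singleton_sublist_append_singleton (s := [a, b, a]).1 hab with h1 | ⟨rfl, h1⟩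
    · exact h.avoids_crossing a b h1
    · exact hs a h1

theorem AvoidingWord.append_min_twice {l : List ℕ} {m : ℕ} (h : AvoidingWord l)
    (hm : ∀ x ∈ l, m < x) : AvoidingWord (l ++ [m, m]) := by
  have hnot : ∀ a, ¬ [a, m, a] <+ l := fun a hs => (hm m (hs.subset (by simp))).false
  have := (h.append_min (fun x hx => (hm x hx).le) (fun a ha => (hnot a ha).elim)).append_min
    (m := m) (by simp only [mem_append, mem_singleton]; rintro x (hx | rfl)
                 exacts [(hm x hx).le, le_rfl])
    (fun a ha => ((append_singleton_sublist_append_singleton (s := [a, m])).1 ha).elim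
      (fun h1 => (hnot a h1).elim) And.left)
  simpa using this

theorem exists_eq_append_of_perm_cons_cons {α : Type*} {l t : List α} {m : α}
    (h : l ~ m :: m :: t) :
    ∃ A B C, l = A ++ m :: (B ++ m :: C) ∧ A ++ (B ++ C) ~ t := by
  have hdup : Duplicate m l := by
    classical
    rw [duplicate_iff_two_le_count, h.count_eq]
    simp
  obtain ⟨A, R, rfl, hR⟩ : ∃ A R, l = A ++ m :: R ∧ m ∈ R := by
    clear h
    induction hdup with
    | cons_mem hm => exact ⟨[], _, rfl, hm⟩
    | @cons_duplicate y _ _ ih =>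
      obtain ⟨A, R, rfl, hR⟩ := ih
      exact ⟨y :: A, R, rfl, hR⟩
  obtain ⟨B, C, rfl⟩ := append_of_mem hR
  refine ⟨A, B, C, rfl, ?_⟩
  have h1 : A ++ (B ++ m :: C) ~ m :: t := (perm_middle.symm.trans h).cons_inv
  rw [← append_assoc] at h1
  simpa using (perm_middle.symm.trans h1).cons_inv

/-- The avoiding words on the `d + 2` doubled letters `m, …, m + d + 1`. -/
def avoidingWords (m : ℕ) : ℕ → Finset (List ℕ)
  | 0 => {[m, m, m + 1, m + 1], [m, m + 1, m + 1, m], [m + 1, m, m, m + 1],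
      [m + 1, m + 1, m, m]}
  | d + 1 => (avoidingWords (m + 1) d).image (· ++ [m, m]) ∪
      {doubledRange m (d + 3), m :: (doubledRange (m + 1) (d + 2) ++ [m])}

theorem avoidingWord_and_perm_of_mem {m d : ℕ} {l : List ℕ} (h : l ∈ avoidingWords m d) :
    AvoidingWord l ∧ l ~ doubledRange m (d + 2) := by
  have hsandwich : ∀ m k, AvoidingWord (m :: (doubledRange (m + 1) k ++ [m])) ∧
      m :: (doubledRange (m + 1) k ++ [m]) ~ doubledRange m (k + 1) := by
    intro m k
    have hsub : (m :: doubledRange (m + 1) k) <+ doubledRange m (k + 1) := sublist_cons_self _ _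
    refine ⟨?_, (perm_append_singleton m _).cons m⟩
    refine AvoidingWord.append_min (l := m :: doubledRange (m + 1) k)
      (.of_pairwise_le ((pairwise_doubledRange m (k + 1)).sublist hsub))
      (fun x hx => (mem_doubledRange.1 (hsub.subset hx)).1) ?_
    intro a ha
    have := (pairwise_doubledRange m (k + 1)).sublist (ha.trans hsub)
    simp at this
    omega
  have hinc : ∀ m k, AvoidingWord (doubledRange m k) := fun m k =>
    .of_pairwise_le (pairwise_doubledRange m k)
  have hdec : ∀ m k l', AvoidingWord l' → l' ~ doubledRange (m + 1) k →
      AvoidingWord (l' ++ [m, m]) ∧ l' ++ [m, m] ~ doubledRange m (k + 1) := by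
    intro m k l' h1 h2
    refine ⟨h1.append_min_twice fun x hx => ?_, ?_⟩
    · exact (mem_doubledRange.1 (h2.mem_iff.1 hx)).1
    · exact perm_append_comm.trans ((h2.cons m).cons m)
  induction d generalizing m l with
  | zero =>
    simp only [avoidingWords, Finset.mem_insert, Finset.mem_singleton] at h
    rcases h with rfl | rfl | rfl | rfl
    · exact ⟨hinc m 2, Perm.refl _⟩
    · exact hsandwich m 1
    · refine ⟨⟨?_, ?_⟩, ?_⟩
      · intro a b c hs
        simp [cons_sublist_cons'] at hs
        omega
      · intro a b hs
        simp [cons_sublist_cons'] at hs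
        omega
      · rw [perm_iff_count]
        intro v
        simp only [doubledRange, count_cons, count_nil]
        ring
    · exact hdec m 1 [m + 1, m + 1] (.of_pairwise_le (by simp)) (Perm.refl _)
  | succ d ih =>
    simp only [avoidingWords, Finset.mem_union, Finset.mem_image, Finset.mem_insert,
      Finset.mem_singleton] at h
    rcases h with ⟨l', hl', rfl⟩ | rfl | rfl
    · exact hdec _ _ _ (ih hl').1 (ih hl').2
    · exact ⟨hinc _ _, Perm.refl _⟩
    · exact hsandwich _ _

theorem mem_avoidingWords {m d : ℕ} {l : List ℕ} (h : AvoidingWord l)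
    (hp : l ~ doubledRange m (d + 2)) : l ∈ avoidingWords m d := by
  induction d generalizing m l with
  | zero =>
    obtain ⟨A, B, C, rfl, hrest⟩ := exists_eq_append_of_perm_cons_cons hp
    have hrest : A ++ (B ++ C) = [m + 1, m + 1] := (perm_replicate (n := 2)).1 hrest
    simp only [append_eq_cons_iff, cons_eq_append_iff, nil_eq_append_iff] at hrest
    have h0101 : ¬ AvoidingWord [m, m + 1, m, m + 1] := fun h =>
      absurd (h.avoids_crossing _ _ (Sublist.refl _)) (by omega)
    have h1010 : ¬ AvoidingWord [m + 1, m, m + 1, m] := fun h =>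
      absurd (h.avoids_crossing _ _ (Sublist.refl _)) (by omega)
    simp only [avoidingWords, Finset.mem_insert, Finset.mem_singleton]
    aesop
  | succ d ih =>
    obtain ⟨A, B, C, rfl, hrest⟩ := exists_eq_append_of_perm_cons_cons hp
    have hne : ∀ a, ∃ x ∈ A ++ (B ++ C), x ≠ a := by
      intro a
      by_contra! hall
      have h1 := hall (m + 1) (hrest.mem_iff.2 (mem_doubledRange.2 (by omega)))
      have h2 := hall (m + 2) (hrest.mem_iff.2 (mem_doubledRange.2 (by omega)))
      omega
    have hgt : ∀ x ∈ A ++ (B ++ C), m < x := fun x hx =>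
      (mem_doubledRange.1 (hrest.mem_iff.1 hx)).1
    have hA : ∀ a ∈ A, ∀ x ∈ B ++ C, x = a := by
      intro a ha x hx
      have hx' : x ∈ B ++ m :: C := by
        rw [mem_append, mem_cons]
        exact (mem_append.1 hx).imp_right Or.inr
      have hs : [a] ++ [m, x] <+ A ++ m :: (B ++ m :: C) :=
        (singleton_sublist.2 ha).append ((singleton_sublist.2 hx').cons_cons m)
      have := h.avoids_three a m x hs
      have := hgt a (mem_append_left _ ha)
      have := hgt x (mem_append_right _ hx)
      omega
    have hB : ∀ b ∈ B, ∀ c ∈ C, c = b := by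
      intro b hb c hc
      have hs : [b] ++ [m, c] <+ B ++ m :: C :=
        (singleton_sublist.2 hb).append ((singleton_sublist.2 hc).cons_cons m)
      have := h.avoids_three b m c (hs.trans ((sublist_cons_self _ _).trans
        (sublist_append_right _ _)))
      have := hgt b (by simp [hb])
      have := hgt c (by simp [hc])
      omega
    simp only [avoidingWords, Finset.mem_union, Finset.mem_image, Finset.mem_insert,
      Finset.mem_singleton]
    rcases A with _ | ⟨a, A⟩
    · right
      have hsorted : B ++ C = doubledRange (m + 1) (d + 2) := by
        refine Perm.eq_of_pairwise' (r := (· ≤ ·)) ?_ (pairwise_doubledRange _ _) hrest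
        rw [pairwise_iff_forall_sublist]
        intro x y hxy
        have hs : [m, x, y] <+ m :: (B ++ m :: C) :=
          (hxy.trans ((sublist_cons_self m C).append_left B)).cons_cons m
        have := h.avoids_three m x y hs
        have := hgt x (hxy.subset (by simp))
        have := hgt y (hxy.subset (by simp))
        omega
      rcases B with _ | ⟨b, B⟩
      · left
        rw [nil_append] at hsorted
        simp [hsorted, doubledRange]
      · rcases C with _ | ⟨c, C⟩
        · right
          rw [append_nil] at hsorted
          simp [hsorted]
        · obtain ⟨x, hx, hxb⟩ := hne b
          have hcb := hB b (by simp) c (by simp)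
          rcases mem_append.1 hx with hx | hx
          · simp at hx
          rcases mem_append.1 hx with hx | hx
          · exact (hxb ((hB x hx c (by simp)).symm.trans hcb)).elim
          · exact (hxb (hB b (by simp) x hx)).elim
    · left
      rcases hBC : B ++ C with _ | ⟨x, R⟩
      · obtain ⟨rfl, rfl⟩ := append_eq_nil_iff.1 hBC
        rw [append_nil, append_nil] at hrest
        exact ⟨a :: A, ih (h.of_sublist (sublist_append_left _ _)) hrest, by simp⟩
      · obtain ⟨y, hy, hya⟩ := hne a
        have hxa := hA a (by simp) x (by simp [hBC])
        rcases mem_append.1 hy with hy | hy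
        · exact (hya ((hA y hy x (by simp [hBC])).symm.trans hxa)).elim
        · exact (hya (hA a (by simp) y hy)).elim

theorem card_avoidingWords (m d : ℕ) : (avoidingWords m d).card = 2 * (d + 2) := by
  induction d generalizing m with
  | zero => simp [avoidingWords]
  | succ d ih =>
    have hhead : ∀ t : List ℕ, m :: t ∉ (avoidingWords (m + 1) d).image (· ++ [m, m]) := by
      intro t ht
      obtain ⟨l, hl, hlt⟩ := Finset.mem_image.1 ht
      have hp := (avoidingWord_and_perm_of_mem hl).2
      cases l with
      | nil => simpa [doubledRange] using hp.length_eq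
      | cons x l =>
        have hx := mem_doubledRange.1 (hp.mem_iff.1 mem_cons_self)
        simp at hlt
        omega
    rw [avoidingWords, Finset.card_union_of_disjoint, Finset.card_image_of_injective, ih,
      Finset.card_pair]
    · ring
    · simp [doubledRange]
    · exact append_left_injective _
    · simp only [Finset.disjoint_insert_right, Finset.disjoint_singleton_right]
      exact ⟨hhead _, hhead _⟩

theorem sublist_finRange_iff {N : ℕ} {l : List (Fin N)} :
    l <+ finRange N ↔ l.Pairwise (· < ·) := by
  refine ⟨fun h => (pairwise_lt_finRange N).sublist h, fun h => ?_⟩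
  have hnd : l.Nodup := h.imp ne_of_lt
  exact sublist_of_subperm_of_pairwise (hnd.subperm fun x _ => mem_finRange x) h
    (pairwise_lt_finRange N)

theorem triple_sublist_ofFn {α : Type*} {N : ℕ} {f : Fin N → α} {a b c : α} :
    [a, b, c] <+ ofFn f ↔ ∃ i j k, i < j ∧ j < k ∧ f i = a ∧ f j = b ∧ f k = c := by
  rw [ofFn_eq_map, sublist_map_iff]
  constructor
  · rintro ⟨l, hl, h⟩
    rw [sublist_finRange_iff] at hl
    obtain ⟨i, l, rfl, rfl, h1⟩ := map_eq_cons_iff.1 h.symm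
    obtain ⟨j, l, rfl, rfl, h2⟩ := map_eq_cons_iff.1 h1
    obtain ⟨k, l, rfl, rfl, h3⟩ := map_eq_cons_iff.1 h2
    simp only [pairwise_cons, mem_cons] at hl
    exact ⟨i, j, k, hl.1 j (by simp), hl.2.1 k (by simp), rfl, rfl, rfl⟩
  · rintro ⟨i, j, k, hij, hjk, rfl, rfl, rfl⟩
    refine ⟨[i, j, k], sublist_finRange_iff.2 ?_, rfl⟩
    simp [hij, hjk, hij.trans hjk]

theorem quadruple_sublist_ofFn {α : Type*} {N : ℕ} {f : Fin N → α} {a b c d : α} :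
    [a, b, c, d] <+ ofFn f ↔
      ∃ i j k l, i < j ∧ j < k ∧ k < l ∧ f i = a ∧ f j = b ∧ f k = c ∧ f l = d := by
  rw [ofFn_eq_map, sublist_map_iff]
  constructor
  · rintro ⟨l, hl, h⟩
    rw [sublist_finRange_iff] at hl
    obtain ⟨i, l, rfl, rfl, h1⟩ := map_eq_cons_iff.1 h.symm
    obtain ⟨j, l, rfl, rfl, h2⟩ := map_eq_cons_iff.1 h1
    obtain ⟨k, l, rfl, rfl, h3⟩ := map_eq_cons_iff.1 h2
    obtain ⟨p, l, rfl, rfl, h4⟩ := map_eq_cons_iff.1 h3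
    simp only [pairwise_cons, mem_cons] at hl
    exact ⟨i, j, k, p, hl.1 j (by simp), hl.2.1 k (by simp), hl.2.2.1 p (by simp),
      rfl, rfl, rfl, rfl⟩
  · rintro ⟨i, j, k, p, hij, hjk, hkp, rfl, rfl, rfl, rfl⟩
    refine ⟨[i, j, k, p], sublist_finRange_iff.2 ?_, rfl⟩
    simp [hij, hjk, hkp, hij.trans hjk, hjk.trans hkp, (hij.trans hjk).trans hkp]

theorem contains3_iff {n : ℕ} {σ : Fin 3 → ℕ} {π : Fin (2 * n) → Fin n} :
    Contains3 n σ π ↔ ∃ i j k, i < j ∧ j < k ∧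
      ∀ a b : Fin 3, ![π i, π j, π k] a < ![π i, π j, π k] b ↔ σ a < σ b := by
  constructor
  · rintro ⟨f, hf, h⟩
    refine ⟨f 0, f 1, f 2, hf (by decide), hf (by decide), fun a b => ?_⟩
    rw [← h]
    fin_cases a <;> fin_cases b <;> rfl
  · rintro ⟨i, j, k, hij, hjk, h⟩
    refine ⟨![i, j, k], ?_, fun a b => ?_⟩
    · rw [Fin.strictMono_iff_lt_succ]
      intro a
      fin_cases a
      exacts [hij, hjk]
    · rw [← h]
      fin_cases a <;> fin_cases b <;> rfl

theorem isMultisetPerm_iff {n : ℕ} {π : Fin (2 * n) → Fin n} :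
    IsMultisetPerm n π ↔ ofFn (fun i => (π i : ℕ)) ~ doubledRange 0 n := by
  have hcount : ∀ v : Fin n,
      (ofFn (fun i => (π i : ℕ))).count (v : ℕ) = Nat.card {i // π i = v} := by
    intro v
    rw [ofFn_eq_map, Nat.card_eq_fintype_card, Fintype.card_subtype, Finset.card_def,
      Finset.filter_val, ← Multiset.countP_eq_card_filter, count, countP_map]
    change _ = Multiset.countP (fun i => π i = v) ((finRange (2 * n) : List _) : Multiset _)
    rw [Multiset.coe_countP]
    exact countP_congr fun i _ => by simp [Fin.ext_iff]
  rw [perm_iff_count]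
  constructor
  · intro h v
    rw [count_doubledRange]
    split_ifs with hv
    · exact (hcount ⟨v, by omega⟩).trans (h _)
    · rw [count_eq_zero, mem_ofFn]
      rintro ⟨i, rfl⟩
      have := (π i).isLt
      omega
  · intro h v
    rw [← hcount, h, count_doubledRange, if_pos (by omega)]

theorem avoidingWord_ofFn_iff {n : ℕ} {π : Fin (2 * n) → Fin n} :
    AvoidingWord (ofFn fun i => (π i : ℕ)) ↔
      (Avoids1212 n π ∧ Avoids2121 n π) ∧ Avoids3 n ![1, 3, 2] π ∧ Avoids3 n ![2, 1, 3] π ∧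
        Avoids3 n ![3, 1, 2] π := by
  simp only [Avoids1212, Avoids2121, Avoids3, contains3_iff, not_exists]
  constructor
  · intro h
    have h4 : ∀ i j k l, i < j → j < k → k < l → π i = π k → π j = π l → π i = π j := by
      intro i j k l hij hjk hkl h1 h2
      apply Fin.ext
      exact h.avoids_crossing _ _ (quadruple_sublist_ofFn.2
        ⟨i, j, k, l, hij, hjk, hkl, rfl, rfl, by rw [h1], by rw [h2]⟩)
    have h3 := fun i j k hij hjk => h.avoids_three _ _ _
      (triple_sublist_ofFn.2 ⟨i, j, k, hij, hjk, rfl, rfl, rfl⟩)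
    refine ⟨⟨?_, ?_⟩, ?_, ?_, ?_⟩
    · rintro i j k l ⟨hij, hjk, hkl, h1, h2, h5⟩
      exact h5.ne (h4 i j k l hij hjk hkl h1 h2)
    · rintro i j k l ⟨hij, hjk, hkl, h1, h2, h5⟩
      exact h5.ne' (h4 i j k l hij hjk hkl h1 h2)
    · rintro i j k ⟨hij, hjk, hσ⟩
      exact (h3 i j k hij hjk).1 ⟨(hσ 0 2).2 (by decide), (hσ 2 1).2 (by decide)⟩
    · rintro i j k ⟨hij, hjk, hσ⟩
      exact (h3 i j k hij hjk).2.1 ⟨(hσ 1 0).2 (by decide), (hσ 0 2).2 (by decide)⟩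
    · rintro i j k ⟨hij, hjk, hσ⟩
      exact (h3 i j k hij hjk).2.2 ⟨(hσ 1 2).2 (by decide), (hσ 2 0).2 (by decide)⟩
  · rintro ⟨⟨h1, h2⟩, h132, h213, h312⟩
    constructor
    · intro a b c hs
      obtain ⟨i, j, k, hij, hjk, rfl, rfl, rfl⟩ := triple_sublist_ofFn.1 hs
      refine ⟨fun h => h132 i j k ⟨hij, hjk, ?_⟩, fun h => h213 i j k ⟨hij, hjk, ?_⟩,
        fun h => h312 i j k ⟨hij, hjk, ?_⟩⟩ <;>
      · simp [Fin.forall_fin_succ]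
        omega
    · intro a b hs
      obtain ⟨i, j, k, l, hij, hjk, hkl, rfl, rfl, h3, h4⟩ := quadruple_sublist_ofFn.1 hs
      rcases lt_trichotomy (π i) (π j) with h | h | h
      · exact (h1 i j k l ⟨hij, hjk, hkl, Fin.ext h3.symm, Fin.ext h4.symm, h⟩).elim
      · rw [h]
      · exact (h2 i j k l ⟨hij, hjk, hkl, Fin.ext h3.symm, Fin.ext h4.symm, h⟩).elim

theorem quasiStirling_avoiding_132_213_312 (n : ℕ) (hn : 2 ≤ n) :
    Nat.card {π : Fin (2 * n) → Fin n //
      IsQuasiStirling n π ∧ Avoids3 n ![1, 3, 2] π ∧ Avoids3 n ![2, 1, 3] π ∧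
        Avoids3 n ![3, 1, 2] π} = 2 * n := by
  obtain ⟨d, rfl⟩ : ∃ d, n = d + 2 := ⟨n - 2, by omega⟩
  have hmem : ∀ π : Fin (2 * (d + 2)) → Fin (d + 2),
      (IsQuasiStirling (d + 2) π ∧ Avoids3 (d + 2) ![1, 3, 2] π ∧
        Avoids3 (d + 2) ![2, 1, 3] π ∧ Avoids3 (d + 2) ![3, 1, 2] π) ↔
      ofFn (fun i => (π i : ℕ)) ∈ avoidingWords 0 d := by
    intro π
    rw [IsQuasiStirling, and_assoc, ← avoidingWord_ofFn_iff, isMultisetPerm_iff]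
    exact ⟨fun h => mem_avoidingWords h.2 h.1, fun h => (avoidingWord_and_perm_of_mem h).symm⟩
  have hcard : Nat.card (avoidingWords 0 d) = 2 * (d + 2) := by
    rw [Nat.card_eq_fintype_card, Fintype.card_coe, card_avoidingWords]
  refine Eq.trans (Nat.card_congr (Equiv.ofBijective
    (fun π => ⟨ofFn (fun i => (π.1 i : ℕ)), (hmem π.1).1 π.2⟩) ⟨?_, ?_⟩)) hcard
  · intro π ρ h
    have := ofFn_injective (Subtype.ext_iff.1 h)
    exact Subtype.ext (funext fun i => Fin.ext (congrFun this i))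
  · rintro ⟨l, hl⟩
    have hp := (avoidingWord_and_perm_of_mem hl).2
    have hlen : l.length = 2 * (d + 2) := hp.length_eq.trans (length_doubledRange _ _)
    have hlt : ∀ i : Fin (2 * (d + 2)), l.get (i.cast hlen.symm) < d + 2 := fun i => by
      simpa using (mem_doubledRange.1 (hp.mem_iff.1 (get_mem l (i.cast hlen.symm)))).2
    have hofFn : ofFn (fun i : Fin (2 * (d + 2)) => l.get (i.cast hlen.symm)) = l := by
      rw [← ofFn_congr hlen, ofFn_get]
    exact ⟨⟨fun i => ⟨_, hlt i⟩, (hmem _).2 (hofFn.symm ▸ hl)⟩, Subtype.ext hofFn⟩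
end

section
/- For every n ≥ 1, the number of quasi-Stirling permutations of the multiset [n,n] that avoid all of the patterns 123, 132, and 213 equals ((1+√2)^{n+1} + (1−√2)^{n+1} − 2·(−1)^{n+1}) / 4 (as a real number; equivalently, the counts q̄_n satisfy q̄_1 = 1, q̄_2 = 4, q̄_3 = 8, and q̄_n = q̄_{n−1} + 3·q̄_{n−2} + q̄_{n−3} for n ≥ 4). -/
/-- No word pattern 123, 132 or 213: an ascent at any distance has only copies of its two ends
in between. -/
def AscentTight (w : List ℕ) : Prop :=
  ∀ a b c, [a, b, c].Sublist w → a < c → b = a ∨ b = c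

/-- No two values interleave as `abab`. -/
def Noncrossing (w : List ℕ) : Prop :=
  ∀ a b, [a, b, a, b].Sublist w → a = b

/-- Each value below `n` occurs exactly twice, and no other value occurs. -/
def IsDoubleWord (n : ℕ) (w : List ℕ) : Prop :=
  ∀ v, w.count v = if v < n then 2 else 0

/-- The words of the quasi-Stirling permutations of `[n,n]` avoiding 123, 132 and 213, with
values shifted down to `0, …, n - 1`. -/
structure IsGoodWord (n : ℕ) (w : List ℕ) : Prop where
  isDoubleWord : IsDoubleWord n w
  ascentTight : AscentTight w
  noncrossing : Noncrossing w

/-- A good block is a word on the values `m, …, m + k - 1`, each occurring twice, with the same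
pattern restrictions as a good word. -/
structure IsGoodBlock (m k : ℕ) (B : List ℕ) : Prop where
  count_eq : ∀ v, B.count v = if m ≤ v ∧ v < m + k then 2 else 0
  ascentTight : AscentTight B
  noncrossing : Noncrossing B

theorem IsGoodWord.lt_of_mem {n v : ℕ} {w : List ℕ} (h : IsGoodWord n w) (hv : v ∈ w) :
    v < n := by
  have := h.isDoubleWord v
  have := List.count_pos_iff.2 hv
  grind

theorem IsGoodBlock.isGoodWord_append_iff {m k : ℕ} {B u : List ℕ} (hB : IsGoodBlock m k B) :
    IsGoodWord (m + k) (B ++ u) ↔ IsGoodWord m u := by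
  have hcount : IsDoubleWord (m + k) (B ++ u) ↔ IsDoubleWord m u := by
    unfold IsDoubleWord
    refine forall_congr' fun v => ?_
    rw [List.count_append, hB.count_eq]
    grind
  have hBm : ∀ v ∈ B, m ≤ v := fun v hv => by
    have := hB.count_eq v
    have := List.count_pos_iff.2 hv
    grind
  constructor
  · rintro ⟨h1, h2, h3⟩
    exact ⟨hcount.1 h1, fun a b c h => h2 a b c (h.trans (List.sublist_append_right _ _)),
      fun a b h => h3 a b (h.trans (List.sublist_append_right _ _))⟩
  · intro hu
    refine ⟨hcount.2 hu.isDoubleWord, fun a b c h hac => ?_, fun a b h => ?_⟩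
    · obtain ⟨l₁, l₂, hl, h₁, h₂⟩ := List.sublist_append_iff.1 h
      have hm₁ : ∀ x ∈ l₁, m ≤ x := fun x hx => hBm x (h₁.subset hx)
      have hm₂ : ∀ x ∈ l₂, x < m := fun x hx => hu.lt_of_mem (h₂.subset hx)
      rcases l₁ with _ | ⟨x, _ | ⟨y, _ | ⟨z, l₁⟩⟩⟩
      · exact hu.ascentTight a b c (by simpa [hl] using h₂) hac
      · obtain ⟨rfl, rfl⟩ : a = x ∧ [b, c] = l₂ := by simpa using hl
        simp at hm₁ hm₂
        omega
      · obtain ⟨rfl, rfl, rfl⟩ : a = x ∧ b = y ∧ [c] = l₂ := by simpa using hl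
        simp at hm₁ hm₂
        omega
      · obtain ⟨rfl, rfl, rfl, rfl, rfl⟩ : a = x ∧ b = y ∧ c = z ∧ l₁ = [] ∧ l₂ = [] := by
          simpa using hl
        exact hB.ascentTight a b c h₁ hac
    · obtain ⟨l₁, l₂, hl, h₁, h₂⟩ := List.sublist_append_iff.1 h
      have hm₁ : ∀ x ∈ l₁, m ≤ x := fun x hx => hBm x (h₁.subset hx)
      have hm₂ : ∀ x ∈ l₂, x < m := fun x hx => hu.lt_of_mem (h₂.subset hx)
      rcases l₁ with _ | ⟨x, _ | ⟨y, _ | ⟨z, _ | ⟨t, l₁⟩⟩⟩⟩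
      · exact hu.noncrossing a b (by simpa [hl] using h₂)
      · obtain ⟨rfl, rfl⟩ : a = x ∧ [b, a, b] = l₂ := by simpa using hl
        simp at hm₁ hm₂
        omega
      · obtain ⟨rfl, rfl, rfl⟩ : a = x ∧ b = y ∧ [a, b] = l₂ := by simpa using hl
        simp at hm₁ hm₂
        omega
      · obtain ⟨rfl, rfl, rfl, rfl⟩ : a = x ∧ b = y ∧ a = z ∧ [b] = l₂ := by simpa using hl
        simp at hm₁ hm₂
        omega
      · obtain ⟨rfl, rfl, rfl, rfl, rfl, rfl⟩ :
            a = x ∧ b = y ∧ a = z ∧ b = t ∧ l₁ = [] ∧ l₂ = [] := by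
          simpa using hl
        exact hB.noncrossing a b h₁

theorem List.cons_sublist_cons_iff {α : Type*} {x y : α} {l l' : List α} :
    (x :: l).Sublist (y :: l') ↔ (x :: l).Sublist l' ∨ x = y ∧ l.Sublist l' := by
  rw [List.sublist_cons_iff]
  grind

theorem isGoodBlock_aa (m : ℕ) : IsGoodBlock m 1 [m, m] := by
  refine ⟨fun v => ?_, fun a b c h hac => ?_, fun a b h => ?_⟩
  · simp only [List.count_cons, List.count_nil, beq_iff_eq]
    grind
  all_goals simp [List.cons_sublist_cons_iff] at h

theorem isGoodBlock_aabb (m : ℕ) : IsGoodBlock m 2 [m, m, m + 1, m + 1] := by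
  refine ⟨fun v => ?_, fun a b c h hac => ?_, fun a b h => ?_⟩
  · simp only [List.count_cons, List.count_nil, beq_iff_eq]
    grind
  all_goals
    simp [List.cons_sublist_cons_iff] at h
    omega

theorem isGoodBlock_baab (m : ℕ) : IsGoodBlock m 2 [m + 1, m, m, m + 1] := by
  refine ⟨fun v => ?_, fun a b c h hac => ?_, fun a b h => ?_⟩
  · simp only [List.count_cons, List.count_nil, beq_iff_eq]
    grind
  all_goals
    simp [List.cons_sublist_cons_iff] at h
    omega

theorem isGoodBlock_abba (m : ℕ) : IsGoodBlock m 2 [m, m + 1, m + 1, m] := by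
  refine ⟨fun v => ?_, fun a b c h hac => ?_, fun a b h => ?_⟩
  · simp only [List.count_cons, List.count_nil, beq_iff_eq]
    grind
  all_goals
    simp [List.cons_sublist_cons_iff] at h
    omega

theorem isGoodBlock_bccaab (m : ℕ) : IsGoodBlock m 3 [m + 1, m + 2, m + 2, m, m, m + 1] := by
  refine ⟨fun v => ?_, fun a b c h hac => ?_, fun a b h => ?_⟩
  · simp only [List.count_cons, List.count_nil, beq_iff_eq]
    grind
  all_goals
    simp [List.cons_sublist_cons_iff] at h
    omega

theorem List.pair_sublist_append {α : Type*} {x y : α} {p s : List α} (hx : x ∈ p)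
    (hy : y ∈ s) : [x, y].Sublist (p ++ s) :=
  (List.singleton_sublist.2 hx).append (List.singleton_sublist.2 hy)

theorem IsGoodWord.mem_of_lt {n v : ℕ} {w : List ℕ} (h : IsGoodWord n w) (hv : v < n) :
    v ∈ w := by
  have := h.isDoubleWord v
  rw [if_pos hv] at this
  exact List.count_pos_iff.1 (by omega)

/-- A good word that starts with its maximum `n` starts with `aa` or `baab`. -/
theorem IsGoodWord.eq_append_of_head_eq {n : ℕ} {t : List ℕ} (h : IsGoodWord (n + 1) (n :: t)) :
    ∃ u, n :: t = [n, n] ++ u ∨ ∃ m, n = m + 1 ∧ n :: t = [m + 1, m, m, m + 1] ++ u := by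
  have hn : n ∈ t := by
    have := h.isDoubleWord n
    simp only [List.count_cons_self] at this
    exact List.count_pos_iff.1 (by grind)
  obtain ⟨p, s, rfl, hp⟩ := List.eq_append_cons_of_mem hn
  rcases p with _ | ⟨a, p⟩
  · exact ⟨s, .inl rfl⟩
  simp only [List.mem_cons, not_or] at hp
  have han : a < n := by
    have := h.lt_of_mem (v := a) (by simp)
    omega
  have hpa : ∀ x ∈ p, x = a := fun x hx =>
    (h.ascentTight a x n
      (.cons _ (.cons_cons _ (List.pair_sublist_append hx (by simp)))) han).resolve_right
      (fun hxn => hp.2 (hxn ▸ hx))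
  obtain ⟨k, rfl⟩ : ∃ k, p = List.replicate k a := ⟨_, List.eq_replicate_of_mem hpa⟩
  have hc := h.isDoubleWord a
  simp only [List.cons_append, List.count_cons, List.count_append, List.count_replicate_self,
    beq_iff_eq] at hc
  rcases k with _ | _ | k
  · have has : a ∈ s := List.count_pos_iff.1 (by grind)
    have := h.noncrossing n a (by simpa [List.cons_sublist_cons_iff] using has)
    omega
  · refine ⟨s, .inr ⟨n - 1, by omega, ?_⟩⟩
    obtain rfl | hne := eq_or_ne n (a + 1)
    · rfl
    have hm : n - 1 ∈ s := by
      have := h.mem_of_lt (v := n - 1) (by omega)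
      simp at this
      grind
    have := h.ascentTight a n (n - 1) (by simp [hm]) (by omega)
    omega
  · grind

/-- A good word that does not start with its maximum `n` starts with `aabb`, `abba` or
`bccaab`. -/
theorem IsGoodWord.eq_append_of_head_ne {n a : ℕ} {t : List ℕ} (h : IsGoodWord (n + 1) (a :: t))
    (hne : a ≠ n) :
    ∃ u m, n = m + 1 ∧ a :: t = [m, m, m + 1, m + 1] ++ u ∨
      n = m + 1 ∧ a :: t = [m, m + 1, m + 1, m] ++ u ∨
      n = m + 2 ∧ a :: t = [m + 1, m + 2, m + 2, m, m, m + 1] ++ u := by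
  have han : a < n := by
    have := h.lt_of_mem (v := a) (by simp)
    omega
  have hn : n ∈ t := by
    have := h.mem_of_lt (v := n) (by omega)
    grind
  obtain ⟨p, s, rfl, hp⟩ := List.eq_append_cons_of_mem hn
  obtain rfl : n = a + 1 := by
    by_contra hna
    have hm : n - 1 ∈ a :: (p ++ n :: s) := h.mem_of_lt (by omega)
    simp only [List.mem_cons, List.mem_append] at hm
    rcases hm with hm | hm | hm | hm
    · omega
    · have := h.ascentTight a (n - 1) n
        (.cons_cons _ (List.pair_sublist_append hm (by simp))) han
      omega
    · omega
    · have := h.ascentTight a n (n - 1)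
        (.cons_cons _ ((List.cons_sublist_cons.2 (List.singleton_sublist.2 hm)).trans
          (List.sublist_append_right _ _))) (by omega)
      omega
  have hpa : ∀ x ∈ p, x = a := fun x hx =>
    (h.ascentTight a x (a + 1)
      (.cons_cons _ (List.pair_sublist_append hx (by simp))) han).resolve_right
      (fun hxn => hp (hxn ▸ hx))
  obtain ⟨k, rfl⟩ : ∃ k, p = List.replicate k a := ⟨_, List.eq_replicate_of_mem hpa⟩
  have hs : a + 1 ∈ s := by
    have := h.isDoubleWord (a + 1)
    simp only [List.count_cons, List.count_append, List.count_replicate, beq_iff_eq] at this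
    exact List.count_pos_iff.1 (by grind)
  obtain ⟨q, s, rfl, hq⟩ := List.eq_append_cons_of_mem hs
  have hqa : ∀ x ∈ q, x = a := fun x hx =>
    (h.ascentTight a x (a + 1)
      (.cons_cons _ ((List.Sublist.cons _ (List.pair_sublist_append hx (by simp))).trans
        (List.sublist_append_right _ _))) han).resolve_right
      (fun hxn => hq (hxn ▸ hx))
  obtain ⟨j, rfl⟩ : ∃ j, q = List.replicate j a := ⟨_, List.eq_replicate_of_mem hqa⟩
  have hc := h.isDoubleWord a
  simp only [List.count_cons, List.count_append, List.count_replicate_self, beq_iff_eq] at hc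
  obtain ⟨rfl, rfl⟩ | ⟨rfl, rfl⟩ | ⟨rfl, rfl⟩ : k = 0 ∧ j = 0 ∨ k = 1 ∧ j = 0 ∨ k = 0 ∧ j = 1 := by
    grind
  · have has : a ∈ s := List.count_pos_iff.1 (by grind)
    obtain ⟨q, r, rfl, hq⟩ := List.eq_append_cons_of_mem has
    rcases q with _ | ⟨b, q⟩
    · exact ⟨r, a, .inr (.inl ⟨rfl, rfl⟩)⟩
    have hc₁ := h.isDoubleWord (a + 1)
    have hb := h.isDoubleWord b
    simp only [List.replicate_zero, List.nil_append, List.cons_append, List.count_cons,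
      List.count_append, beq_iff_eq] at hc₁ hb
    simp only [List.mem_cons, not_or] at hq
    have hba : b < a := by grind
    have hqb : ∀ x ∈ q, x = b := fun x hx =>
      (h.ascentTight b x a
        (.cons _ (.cons _ (.cons _ (.cons_cons _ (List.pair_sublist_append hx (by simp))))))
        hba).resolve_right (fun hxn => hq.2 (hxn ▸ hx))
    obtain ⟨i, rfl⟩ : ∃ i, q = List.replicate i b := ⟨_, List.eq_replicate_of_mem hqb⟩
    rw [List.count_replicate_self] at hb
    rcases i with _ | _ | i
    · have hbr : b ∈ r := List.count_pos_iff.1 (by grind)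
      have := h.noncrossing a b (by simp [hbr])
      omega
    · obtain rfl | hne := eq_or_ne a (b + 1)
      · exact ⟨r, b, .inr (.inr ⟨rfl, rfl⟩)⟩
      have hm : a - 1 ∈ r := by
        have := h.mem_of_lt (v := a - 1) (by omega)
        simp at this
        grind
      have := h.ascentTight b a (a - 1) (by simp [List.cons_sublist_cons_iff, hm]) (by omega)
      omega
    · grind
  · exact ⟨s, a, .inl ⟨rfl, rfl⟩⟩
  · have := h.noncrossing a (a + 1) (by simp)
    omega

/-- The good words of each size, built by prepending blocks. -/
def goodWords : ℕ → Finset (List ℕ)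
  | 0 => {[]}
  | 1 => {[0, 0]}
  | 2 => {[1, 1, 0, 0], [0, 0, 1, 1], [1, 0, 0, 1], [0, 1, 1, 0]}
  | m + 3 =>
    (goodWords (m + 2)).image ([m + 2, m + 2] ++ ·) ∪
    ((goodWords (m + 1)).image ([m + 1, m + 1, m + 2, m + 2] ++ ·) ∪
    ((goodWords (m + 1)).image ([m + 2, m + 1, m + 1, m + 2] ++ ·) ∪
    ((goodWords (m + 1)).image ([m + 1, m + 2, m + 2, m + 1] ++ ·) ∪
    (goodWords m).image ([m + 1, m + 2, m + 2, m, m, m + 1] ++ ·))))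

theorem isGoodWord_zero_iff {w : List ℕ} : IsGoodWord 0 w ↔ w = [] := by
  constructor
  · exact fun h => List.eq_nil_iff_forall_not_mem.2 fun v hv => by simpa using h.lt_of_mem hv
  · rintro rfl
    exact ⟨fun v => by simp, fun a b c h => by simp at h, fun a b h => by simp at h⟩

theorem isGoodWord_succ_iff {n : ℕ} {w : List ℕ} :
    IsGoodWord (n + 1) w ↔
      (∃ u, IsGoodWord n u ∧ w = [n, n] ++ u) ∨
      (∃ m u, n = m + 1 ∧ IsGoodWord m u ∧ (w = [m, m, m + 1, m + 1] ++ u ∨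
        w = [m + 1, m, m, m + 1] ++ u ∨ w = [m, m + 1, m + 1, m] ++ u)) ∨
      (∃ m u, n = m + 2 ∧ IsGoodWord m u ∧
        w = [m + 1, m + 2, m + 2, m, m, m + 1] ++ u) := by
  constructor
  · intro h
    rcases w with _ | ⟨a, t⟩
    · simpa using h.mem_of_lt n.lt_succ_self
    obtain rfl | hne := eq_or_ne a n
    · obtain ⟨u, hu | ⟨m, rfl, hu⟩⟩ := h.eq_append_of_head_eq <;> rw [hu] at h
      · exact .inl ⟨u, (isGoodBlock_aa _).isGoodWord_append_iff.1 h, hu⟩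
      · exact .inr (.inl ⟨m, u, rfl, (isGoodBlock_baab _).isGoodWord_append_iff.1 h,
          .inr (.inl hu)⟩)
    · obtain ⟨u, m, ⟨rfl, hu⟩ | ⟨rfl, hu⟩ | ⟨rfl, hu⟩⟩ := h.eq_append_of_head_ne hne <;>
        rw [hu] at h
      · exact .inr (.inl ⟨m, u, rfl, (isGoodBlock_aabb _).isGoodWord_append_iff.1 h, .inl hu⟩)
      · exact .inr (.inl ⟨m, u, rfl, (isGoodBlock_abba _).isGoodWord_append_iff.1 h,
          .inr (.inr hu)⟩)
      · exact .inr (.inr ⟨m, u, rfl, (isGoodBlock_bccaab _).isGoodWord_append_iff.1 h, hu⟩)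
  · rintro (⟨u, hu, rfl⟩ | ⟨m, u, rfl, hu, rfl | rfl | rfl⟩ | ⟨m, u, rfl, hu, rfl⟩)
    · exact (isGoodBlock_aa _).isGoodWord_append_iff.2 hu
    · exact (isGoodBlock_aabb _).isGoodWord_append_iff.2 hu
    · exact (isGoodBlock_baab _).isGoodWord_append_iff.2 hu
    · exact (isGoodBlock_abba _).isGoodWord_append_iff.2 hu
    · exact (isGoodBlock_bccaab _).isGoodWord_append_iff.2 hu

theorem mem_goodWords {n : ℕ} {w : List ℕ} : w ∈ goodWords n ↔ IsGoodWord n w := by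
  induction n using goodWords.induct generalizing w with
  | case1 => simp [goodWords, isGoodWord_zero_iff]
  | case2 => simp [goodWords, isGoodWord_succ_iff, isGoodWord_zero_iff]
  | case3 =>
    rw [isGoodWord_succ_iff]
    simp [goodWords, isGoodWord_succ_iff, isGoodWord_zero_iff]
  | case4 m h₂ h₁ h₀ =>
    rw [isGoodWord_succ_iff]
    simp only [goodWords, Finset.mem_union, Finset.mem_image, h₀, h₁, h₂]
    grind

theorem card_goodWords_add_three (m : ℕ) :
    (goodWords (m + 3)).card =
      (goodWords (m + 2)).card + 3 * (goodWords (m + 1)).card + (goodWords m).card := by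
  rw [goodWords]
  repeat rw [Finset.card_union_of_disjoint (by
    simp [Finset.disjoint_left, forall_and])]
  simp only [Finset.card_image_of_injective _ (List.append_right_injective _)]
  ring

theorem card_goodWords (n : ℕ) : ((goodWords n).card : ℝ) =
    ((1 + Real.sqrt 2) ^ (n + 1) + (1 - Real.sqrt 2) ^ (n + 1) - 2 * (-1 : ℝ) ^ (n + 1)) / 4 := by
  have hs : Real.sqrt 2 ^ 2 = 2 := Real.sq_sqrt zero_le_two
  induction n using goodWords.induct with
  | case1 => norm_num [goodWords]
  | case2 =>
    simp only [goodWords, Finset.card_singleton]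
    push_cast
    linear_combination (-1 / 2) * hs
  | case3 =>
    have : (goodWords 2).card = 4 := by decide
    rw [this]
    push_cast
    linear_combination (-3 / 2) * hs
  | case4 m h₂ h₁ h₀ =>
    change _ = ((1 + Real.sqrt 2) ^ (m + 3 + 1) + (1 - Real.sqrt 2) ^ (m + 3 + 1) -
      2 * (-1 : ℝ) ^ (m + 3 + 1)) / 4
    rw [card_goodWords_add_three]
    push_cast
    rw [h₀, h₁, h₂]
    have h₃ : (1 + Real.sqrt 2) ^ 3 = (1 + Real.sqrt 2) ^ 2 + 3 * (1 + Real.sqrt 2) + 1 := by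
      linear_combination (2 + Real.sqrt 2) * hs
    have h₄ : (1 - Real.sqrt 2) ^ 3 = (1 - Real.sqrt 2) ^ 2 + 3 * (1 - Real.sqrt 2) + 1 := by
      linear_combination (2 - Real.sqrt 2) * hs
    linear_combination (-(1 + Real.sqrt 2) ^ (m + 1) / 4) * h₃ -
      (1 - Real.sqrt 2) ^ (m + 1) / 4 * h₄

theorem List.sublist_ofFn_iff {α : Type*} {N : ℕ} {f : Fin N → α} {l : List α} :
    l.Sublist (List.ofFn f) ↔ ∃ l' : List (Fin N), l'.Pairwise (· < ·) ∧ l = l'.map f := by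
  rw [List.ofFn_eq_map, List.sublist_map_iff]
  refine exists_congr fun l' => and_congr_left fun _ =>
    ⟨fun h => (List.pairwise_lt_finRange N).sublist h, fun h => ?_⟩
  exact List.sublist_of_subperm_of_pairwise
    (List.subperm_of_subset (h.imp ne_of_lt) fun x _ => List.mem_finRange x) h
    (List.pairwise_lt_finRange N)

theorem List.count_ofFn_eq_card {α : Type*} [DecidableEq α] {N : ℕ} (f : Fin N → α) (a : α) :
    (List.ofFn f).count a = Nat.card {i // f i = a} := by
  rw [Nat.card_eq_fintype_card, Fintype.card_subtype]
  simpa using (Fin.card_filter_univ_eq_vector_get_eq_count a (List.Vector.ofFn f)).symm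

/-- The sequence of values of `π`, as a list of natural numbers. -/
def wordOf {n : ℕ} (π : Fin (2 * n) → Fin n) : List ℕ :=
  List.ofFn fun i => (π i : ℕ)

theorem wordOf_injective {n : ℕ} : Function.Injective (wordOf (n := n)) := fun π ρ h => by
  have := List.ofFn_injective h
  exact funext fun i => Fin.ext (congrFun this i)

theorem ascentTight_wordOf_iff {n : ℕ} {π : Fin (2 * n) → Fin n} :
    AscentTight (wordOf π) ↔
      ∀ i j k, i < j → j < k → π i < π k → π j = π i ∨ π j = π k := by
  constructor
  · intro h i j k hij hjk hik
    have := h (π i) (π j) (π k)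
      (List.sublist_ofFn_iff.2 ⟨[i, j, k], by simp [hij, hjk, hij.trans hjk], rfl⟩) hik
    simpa only [Fin.ext_iff] using this
  · intro h a b c habc hac
    obtain ⟨l, hl, hmap⟩ := List.sublist_ofFn_iff.1 habc
    rcases l with _ | ⟨i, _ | ⟨j, _ | ⟨k, _ | ⟨x, l⟩⟩⟩⟩ <;> simp at hmap
    obtain ⟨rfl, rfl, rfl⟩ := hmap
    simp at hl
    simpa only [Fin.ext_iff] using h i j k hl.1.1 hl.2 hac

theorem avoids3_iff_ascentTight {n : ℕ} {π : Fin (2 * n) → Fin n} :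
    (Avoids3 n ![1, 2, 3] π ∧ Avoids3 n ![1, 3, 2] π ∧ Avoids3 n ![2, 1, 3] π) ↔
      AscentTight (wordOf π) := by
  rw [ascentTight_wordOf_iff]
  constructor
  · rintro ⟨h₁, h₂, h₃⟩ i j k hij hjk hik
    by_contra! hj
    have hf : StrictMono ![i, j, k] := by
      simp [Fin.strictMono_iff_lt_succ, Fin.forall_fin_succ, hij, hjk]
    rcases lt_or_gt_of_ne hj.1 with hji | hij'
    · exact h₃ ⟨_, hf, by simp [Fin.forall_fin_succ]; grind⟩
    rcases lt_or_gt_of_ne hj.2 with hjk' | hkj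
    · exact h₁ ⟨_, hf, by simp [Fin.forall_fin_succ]; grind⟩
    · exact h₂ ⟨_, hf, by simp [Fin.forall_fin_succ]; grind⟩
  · intro h
    refine ⟨?_, ?_, ?_⟩ <;>
    · rintro ⟨f, hf, hσ⟩
      have := h (f 0) (f 1) (f 2) (hf (by decide)) (hf (by decide))
      simp [Fin.forall_fin_succ] at hσ
      grind

theorem noncrossing_wordOf_iff {n : ℕ} {π : Fin (2 * n) → Fin n} :
    Noncrossing (wordOf π) ↔ Avoids1212 n π ∧ Avoids2121 n π := by
  constructor
  · intro h
    have key : ∀ i j k l : Fin (2 * n), i < j → j < k → k < l → π i = π k → π j = π l →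
        π i = π j := fun i j k l hij hjk hkl hik hjl => by
      refine Fin.ext (h (π i) (π j) (List.sublist_ofFn_iff.2 ⟨[i, j, k, l], ?_, ?_⟩))
      · simp
        grind
      · simp [hik, hjl]
    constructor
    · rintro ⟨i, j, k, l, hij, hjk, hkl, hik, hjl, hlt⟩
      exact hlt.ne (key i j k l hij hjk hkl hik hjl)
    · rintro ⟨i, j, k, l, hij, hjk, hkl, hik, hjl, hlt⟩
      exact hlt.ne' (key i j k l hij hjk hkl hik hjl)
  · rintro ⟨h₁, h₂⟩ a b hab
    obtain ⟨s, hs, hmap⟩ := List.sublist_ofFn_iff.1 hab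
    rcases s with _ | ⟨i, _ | ⟨j, _ | ⟨k, _ | ⟨l, _ | ⟨x, s⟩⟩⟩⟩⟩ <;> simp at hmap
    obtain ⟨rfl, rfl, hik, hjl⟩ := hmap
    simp at hs
    by_contra hne
    rcases lt_or_gt_of_ne hne with hlt | hlt
    · exact h₁ ⟨i, j, k, l, hs.1.1, hs.2.1.1, hs.2.2, Fin.ext hik, Fin.ext hjl, hlt⟩
    · exact h₂ ⟨i, j, k, l, hs.1.1, hs.2.1.1, hs.2.2, Fin.ext hik, Fin.ext hjl, hlt⟩

theorem isDoubleWord_wordOf_iff {n : ℕ} {π : Fin (2 * n) → Fin n} :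
    IsDoubleWord n (wordOf π) ↔ IsMultisetPerm n π := by
  constructor
  · intro h v
    simpa [wordOf, List.count_ofFn_eq_card, Fin.val_inj] using h v
  · intro h v
    split_ifs with hv
    · simpa [wordOf, List.count_ofFn_eq_card, Fin.ext_iff] using h ⟨v, hv⟩
    · refine List.count_eq_zero.2 fun hmem => hv ?_
      obtain ⟨i, rfl⟩ := List.mem_ofFn.1 hmem
      exact (π i).isLt

theorem isGoodWord_wordOf_iff {n : ℕ} {π : Fin (2 * n) → Fin n} :
    IsGoodWord n (wordOf π) ↔
      IsQuasiStirling n π ∧ Avoids3 n ![1, 2, 3] π ∧ Avoids3 n ![1, 3, 2] π ∧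
        Avoids3 n ![2, 1, 3] π := by
  rw [avoids3_iff_ascentTight, IsQuasiStirling, ← noncrossing_wordOf_iff,
    ← isDoubleWord_wordOf_iff]
  exact ⟨fun ⟨h₁, h₂, h₃⟩ => ⟨⟨h₁, h₃⟩, h₂⟩, fun ⟨⟨h₁, h₃⟩, h₂⟩ => ⟨h₁, h₂, h₃⟩⟩

theorem IsGoodWord.length_eq {n : ℕ} {w : List ℕ} (h : IsGoodWord n w) : w.length = 2 * n := by
  have := Multiset.sum_count_eq_card (s := Finset.range n) (m := (w : Multiset ℕ))
    fun v hv => Finset.mem_range.2 (h.lt_of_mem (Multiset.mem_coe.1 hv))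
  simp only [Multiset.coe_count, Multiset.coe_card] at this
  rw [← this, Finset.sum_congr rfl fun v hv => (h.isDoubleWord v).trans
    (if_pos (Finset.mem_range.1 hv))]
  simp [mul_comm]

theorem IsGoodWord.exists_wordOf_eq {n : ℕ} {w : List ℕ} (h : IsGoodWord n w) :
    ∃ π : Fin (2 * n) → Fin n, wordOf π = w := by
  have hlen := h.length_eq
  refine ⟨fun i => ⟨w[i]'(by omega), h.lt_of_mem (List.getElem_mem _)⟩, ?_⟩
  exact List.ext_getElem (by simp [wordOf, hlen]) fun i _ _ => by simp [wordOf]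

theorem quasiStirling_avoiding_123_132_213 (n : ℕ) (hn : 1 ≤ n) :
    (Nat.card {π : Fin (2 * n) → Fin n //
        IsQuasiStirling n π ∧ Avoids3 n ![1, 2, 3] π ∧ Avoids3 n ![1, 3, 2] π ∧
          Avoids3 n ![2, 1, 3] π} : ℝ) =
      ((1 + Real.sqrt 2) ^ (n + 1) + (1 - Real.sqrt 2) ^ (n + 1) -
        2 * (-1 : ℝ) ^ (n + 1)) / 4 := by
  have himage : wordOf '' {π : Fin (2 * n) → Fin n | IsGoodWord n (wordOf π)} =
      goodWords n := by
    ext w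
    simp only [Set.mem_image, Set.mem_ofPred_eq, Finset.mem_coe, mem_goodWords]
    constructor
    · rintro ⟨π, h, rfl⟩
      exact h
    · intro h
      obtain ⟨π, rfl⟩ := h.exists_wordOf_eq
      exact ⟨π, h, rfl⟩
  simp only [← isGoodWord_wordOf_iff]
  rw [← card_goodWords, ← Set.ncard_coe_finset, ← himage,
    Set.ncard_image_of_injective _ wordOf_injective]
  rfl
end

section
/- For every n ≥ 1, the number of quasi-Stirling permutations of the multiset [n,n] that avoid all of the patterns 123, 132, and 312 equals (n² + 3n − 2)/2. -/
/-- The rank of the position `k` among the positions different from `p` and `q`. -/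
def rankOff (p q k : ℕ) : ℕ :=
  k - (if p < k then 1 else 0) - (if q < k then 1 else 0)

/-- The entries of the word which has its two largest entries `n - 1` at the positions `p` and `q`
and is otherwise the weakly decreasing word `(n-2)(n-2)⋯1100`. -/
def topWordVal (n p q k : ℕ) : ℕ :=
  if k = p ∨ k = q then n - 1 else n - 2 - rankOff p q k / 2

lemma topWordVal_lt {n : ℕ} (hn : 1 ≤ n) (p q k : ℕ) : topWordVal n p q k < n := by
  unfold topWordVal
  split_ifs <;> omega

/-- `topWordVal` as a map from positions to letters. -/
def topWord (n : ℕ) (hn : 1 ≤ n) (x : ℕ × ℕ) : Fin (2 * n) → Fin n :=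
  fun k => ⟨topWordVal n x.1 x.2 k, topWordVal_lt hn _ _ _⟩

/-- The positions of the largest letter for which `topWord` is noncrossing. -/
def topPositions (n : ℕ) : Set (ℕ × ℕ) :=
  {x | x.1 < x.2 ∧ x.2 < 2 * n ∧ (x.2 = x.1 + 1 ∨ (x.1 % 2 = 0 ∧ x.2 % 2 = 1))}

lemma topWordVal_eq_top_iff {n p q k : ℕ} (hpq : p < q) (hq : q < 2 * n) (hk : k < 2 * n) :
    topWordVal n p q k = n - 1 ↔ k = p ∨ k = q := by
  unfold topWordVal rankOff
  split_ifs <;> omega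

lemma contains3_of_lt {n : ℕ} {σ : Fin 3 → ℕ} {π : Fin (2 * n) → Fin n} {i j k : Fin (2 * n)}
    (hij : i < j) (hjk : j < k)
    (h : ∀ a b : Fin 3, π (![i, j, k] a) < π (![i, j, k] b) ↔ σ a < σ b) :
    Contains3 n σ π := by
  refine ⟨![i, j, k], ?_, h⟩
  rw [Fin.strictMono_iff_lt_succ]
  intro a
  fin_cases a
  · exact hij
  · exact hjk

/-- Every ascent of `π`, adjacent or not, ends in the largest letter. -/
def AscentsToTop (n : ℕ) (π : Fin (2 * n) → Fin n) : Prop :=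
  ∀ i j : Fin (2 * n), i < j → π i < π j → (π j : ℕ) = n - 1

lemma avoids_iff_ascentsToTop {n : ℕ} {π : Fin (2 * n) → Fin n}
    (htop : ∃ m, (π m : ℕ) = n - 1) :
    (Avoids3 n ![1, 2, 3] π ∧ Avoids3 n ![1, 3, 2] π ∧ Avoids3 n ![3, 1, 2] π) ↔
      AscentsToTop n π := by
  constructor
  · rintro ⟨h₁, h₂, h₃⟩ i j hij hπ
    by_contra hj
    obtain ⟨m, hm⟩ := htop
    have hjm : π j < π m := by
      rw [Fin.lt_def]
      omega
    have him : π i < π m := hπ.trans hjm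
    rcases lt_trichotomy m i with h | rfl | h
    · refine h₃ (contains3_of_lt h hij fun a b => ?_)
      fin_cases a <;> fin_cases b <;> simp [hπ, hjm, him, hπ.le, hjm.le, him.le]
    · exact absurd him (lt_irrefl _)
    · rcases lt_trichotomy m j with h' | rfl | h'
      · refine h₂ (contains3_of_lt h h' fun a b => ?_)
        fin_cases a <;> fin_cases b <;> simp [hπ, hjm, him, hπ.le, hjm.le, him.le]
      · exact absurd hjm (lt_irrefl _)
      · refine h₁ (contains3_of_lt hij h' fun a b => ?_)
        fin_cases a <;> fin_cases b <;> simp [hπ, hjm, him, hπ.le, hjm.le, him.le]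
  · intro h
    refine ⟨?_, ?_, ?_⟩
    · rintro ⟨f, hf, hσ⟩
      have h01 : π (f 0) < π (f 1) := (hσ 0 1).2 (by simp)
      have h12 : π (f 1) < π (f 2) := (hσ 1 2).2 (by simp)
      have := h _ _ (hf (by decide)) h01
      rw [Fin.lt_def] at h12
      omega
    · rintro ⟨f, hf, hσ⟩
      have h02 : π (f 0) < π (f 2) := (hσ 0 2).2 (by simp)
      have h21 : π (f 2) < π (f 1) := (hσ 2 1).2 (by simp)
      have := h _ _ (hf (by decide)) h02
      rw [Fin.lt_def] at h21
      omega
    · rintro ⟨f, hf, hσ⟩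
      have h12 : π (f 1) < π (f 2) := (hσ 1 2).2 (by simp)
      have h20 : π (f 2) < π (f 0) := (hσ 2 0).2 (by simp)
      have := h _ _ (hf (by decide)) h12
      rw [Fin.lt_def] at h20
      omega

lemma isMultisetPerm_topWord {n : ℕ} (hn : 1 ≤ n) {p q : ℕ} (hpq : p < q) (hq : q < 2 * n) :
    IsMultisetPerm n (topWord n hn (p, q)) := by
  intro v
  have hv := v.isLt
  suffices h : ∃ a b : Fin (2 * n), a ≠ b ∧ {i | topWord n hn (p, q) i = v} = {a, b} from
    Set.ncard_eq_two.2 h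
  by_cases htop : (v : ℕ) = n - 1
  · refine ⟨⟨p, by omega⟩, ⟨q, hq⟩, by simpa [Fin.ext_iff] using hpq.ne, ?_⟩
    ext i
    simp only [topWord, Set.mem_ofPred_eq, Set.mem_insert_iff, Set.mem_singleton_iff, Fin.ext_iff,
      htop]
    exact topWordVal_eq_top_iff hpq hq i.isLt
  · let e : ℕ → ℕ := fun m => if m < p then m else if m + 1 < q then m + 1 else m + 2
    have he : ∀ m, m < 2 * n - 2 → e m < 2 * n := by
      intro m hm
      simp only [e]
      split_ifs <;> omega
    refine ⟨⟨e (2 * (n - 2 - v)), he _ (by omega)⟩, ⟨e (2 * (n - 2 - v) + 1), he _ (by omega)⟩,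
      ?_, ?_⟩
    · simp only [ne_eq, Fin.ext_iff, e]
      split_ifs <;> omega
    · ext i
      have hi := i.isLt
      simp only [topWord, topWordVal, rankOff, e, Set.mem_ofPred_eq, Set.mem_insert_iff,
        Set.mem_singleton_iff, Fin.ext_iff]
      split_ifs <;> omega

lemma ascentsToTop_topWord {n : ℕ} (hn : 1 ≤ n) {p q : ℕ} (hpq : p < q) :
    AscentsToTop n (topWord n hn (p, q)) := by
  intro i j hij h
  rw [Fin.lt_def] at hij h
  simp only [topWord, topWordVal, rankOff] at h ⊢
  split_ifs at h ⊢ <;> omega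

lemma topWordVal_not_crossing {n : ℕ} {x : ℕ × ℕ} (hx : x ∈ topPositions n)
    {i j k l : ℕ} (hij : i < j) (hjk : j < k) (hkl : k < l) (hl : l < 2 * n)
    (hik : topWordVal n x.1 x.2 i = topWordVal n x.1 x.2 k)
    (hjl : topWordVal n x.1 x.2 j = topWordVal n x.1 x.2 l)
    (hne : topWordVal n x.1 x.2 i ≠ topWordVal n x.1 x.2 j) : False := by
  obtain ⟨p, q⟩ := x
  obtain ⟨hpq, hq, hcond⟩ := hx
  have key : ∀ {a b : ℕ}, a < b → b < 2 * n → topWordVal n p q a = topWordVal n p q b →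
      (a = p ∧ b = q) ∨ (a ≠ p ∧ a ≠ q ∧ b ≠ p ∧ b ≠ q ∧
        rankOff p q a % 2 = 0 ∧ rankOff p q b = rankOff p q a + 1) := by
    intro a b hab hb h
    simp only [topWordVal, rankOff] at h ⊢
    split_ifs at h ⊢ <;> omega
  have h₁ := key (hij.trans hjk) (by omega) hik
  have h₂ := key (hjk.trans hkl) hl hjl
  simp only [rankOff] at h₁ h₂
  dsimp only at hpq hq hcond
  split_ifs at h₁ h₂ <;> omega

lemma isQuasiStirling_topWord {n : ℕ} (hn : 1 ≤ n) {x : ℕ × ℕ} (hx : x ∈ topPositions n) :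
    IsQuasiStirling n (topWord n hn x) := by
  refine ⟨isMultisetPerm_topWord hn hx.1 hx.2.1, ?_, ?_⟩
  · rintro ⟨i, j, k, l, hij, hjk, hkl, hik, hjl, h⟩
    exact topWordVal_not_crossing hx hij hjk hkl l.isLt (Fin.ext_iff.1 hik) (Fin.ext_iff.1 hjl)
      (Fin.lt_def.1 h).ne
  · rintro ⟨i, j, k, l, hij, hjk, hkl, hik, hjl, h⟩
    exact topWordVal_not_crossing hx hij hjk hkl l.isLt (Fin.ext_iff.1 hik) (Fin.ext_iff.1 hjl)
      (Fin.lt_def.1 h).ne'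

lemma mem_topPositions_of_isQuasiStirling {n : ℕ} (hn : 1 ≤ n) {p q : ℕ} (hpq : p < q)
    (hq : q < 2 * n) (h : IsQuasiStirling n (topWord n hn (p, q))) :
    (p, q) ∈ topPositions n := by
  refine ⟨hpq, hq, ?_⟩
  by_contra! hcond
  obtain ⟨hne, hcond⟩ := hcond
  dsimp only at hne hcond
  obtain ⟨-, h₁, h₂⟩ := h
  have hvp : topWordVal n p q p = n - 1 := (topWordVal_eq_top_iff hpq hq (by omega)).2 (Or.inl rfl)
  have hvq : topWordVal n p q q = n - 1 := (topWordVal_eq_top_iff hpq hq hq).2 (Or.inr rfl)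
  by_cases hp : p % 2 = 0
  · obtain ⟨c, rfl⟩ : ∃ c, q = 2 * c + 2 := ⟨q / 2 - 1, by omega⟩
    have hv₁ : topWordVal n p (2 * c + 2) (2 * c + 1) = n - 2 - c := by
      unfold topWordVal rankOff
      split_ifs <;> omega
    have hv₂ : topWordVal n p (2 * c + 2) (2 * c + 3) = n - 2 - c := by
      unfold topWordVal rankOff
      split_ifs <;> omega
    refine h₂ ⟨⟨p, by omega⟩, ⟨2 * c + 1, by omega⟩, ⟨2 * c + 2, hq⟩, ⟨2 * c + 3, by omega⟩,
      ?_, ?_, ?_, ?_, ?_, ?_⟩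
    all_goals simp only [Fin.lt_def, topWord, hvp, hvq, hv₁, hv₂]
    all_goals omega
  · obtain ⟨c, rfl⟩ : ∃ c, p = 2 * c + 1 := ⟨p / 2, by omega⟩
    have hv₁ : topWordVal n (2 * c + 1) q (2 * c) = n - 2 - c := by
      unfold topWordVal rankOff
      split_ifs <;> omega
    have hv₂ : topWordVal n (2 * c + 1) q (2 * c + 2) = n - 2 - c := by
      unfold topWordVal rankOff
      split_ifs <;> omega
    refine h₁ ⟨⟨2 * c, by omega⟩, ⟨2 * c + 1, by omega⟩, ⟨2 * c + 2, by omega⟩, ⟨q, hq⟩,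
      ?_, ?_, ?_, ?_, ?_, ?_⟩
    all_goals simp only [Fin.lt_def, topWord, hvp, hvq, hv₁, hv₂]
    all_goals omega

lemma IsMultisetPerm.card_filter_mem {n : ℕ} {π : Fin (2 * n) → Fin n} (h : IsMultisetPerm n π)
    (s : Finset (Fin n)) : (Finset.univ.filter fun i => π i ∈ s).card = 2 * s.card := by
  rw [Finset.card_eq_sum_card_fiberwise (f := π) (t := s) (fun i hi => by simpa using hi),
    Finset.sum_const_nat (m := 2), mul_comm]
  intro v hv
  refine Eq.trans ?_ (h v)
  rw [Nat.card_eq_fintype_card, Fintype.card_subtype, Finset.filter_filter]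
  congr 1
  ext i
  simp only [Finset.mem_filter, Finset.mem_univ, true_and]
  exact ⟨fun h => h.2, fun h => ⟨h ▸ hv, h⟩⟩

lemma eq_topWord {n : ℕ} (hn : 1 ≤ n) {π : Fin (2 * n) → Fin n} (hπ : IsMultisetPerm n π)
    (hasc : AscentsToTop n π) :
    ∃ p q : ℕ, p < q ∧ q < 2 * n ∧ π = topWord n hn (p, q) := by
  obtain ⟨p, q, hpq, htop⟩ : ∃ p q : Fin (2 * n), p < q ∧
      ∀ i, (π i : ℕ) = n - 1 ↔ i = p ∨ i = q := by
    obtain ⟨a, b, hab, h⟩ := Set.ncard_eq_two.1 (hπ ⟨n - 1, by omega⟩)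
    have h' : ∀ i, (π i : ℕ) = n - 1 ↔ i = a ∨ i = b := fun i => by
      
      rw [← Set.mem_singleton_iff (b := b), ← Set.mem_insert_iff, ← h]
      exact (Fin.ext_iff (a := π i) (b := ⟨n - 1, by omega⟩)).symm
    rcases lt_or_gt_of_ne hab with hlt | hlt
    · exact ⟨a, b, hlt, h'⟩
    · exact ⟨b, a, hlt, fun i => (h' i).trans or_comm⟩
  refine ⟨p, q, hpq, q.isLt, funext fun k => Fin.ext ?_⟩
  by_cases hk : k = p ∨ k = q
  · rw [(htop k).2 hk]
    simp only [topWord, topWordVal, ← Fin.ext_iff, if_pos hk]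
  have hkn : (π k : ℕ) ≠ n - 1 := fun h => hk ((htop k).1 h)
  let B := ((Finset.Iio k).erase p).erase q
  have hB : B.card = rankOff p q k := by
    simp only [B, rankOff, Finset.card_erase_eq_ite, Finset.mem_erase, Finset.mem_Iio,
      Fin.card_Iio, Fin.lt_def]
    have : (q : ℕ) ≠ p := fun h => hpq.ne' (Fin.ext h)
    have : q ≠ p := hpq.ne'
    split_ifs <;> simp_all
  have hC : (insert p (insert q B)).card = rankOff p q k + 2 := by
    rw [Finset.card_insert_of_notMem, Finset.card_insert_of_notMem, hB]
    · simp [B]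
    · simp [B, hpq.ne]
  have hlow : 2 * (Finset.Ioi (π k)).card ≤ rankOff p q k + 2 := by
    rw [← hπ.card_filter_mem, ← hC]
    refine Finset.card_le_card fun i hi => ?_
    simp only [Finset.mem_filter, Finset.mem_univ, true_and, Finset.mem_Ioi] at hi
    by_cases hi' : i = p ∨ i = q
    · simp only [Finset.mem_insert]
      tauto
    · push Not at hi'
      have hik : i < k := by
        rcases lt_trichotomy i k with h | rfl | h
        · exact h
        · exact absurd hi (lt_irrefl _)
        · exact absurd ((htop i).1 (hasc k i h hi)) (by tauto)
      simp [B, hi', hik]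
  have hup : rankOff p q k + 2 < 2 * (Finset.Ici (π k)).card := by
    rw [← hπ.card_filter_mem, ← hC]
    refine Finset.card_lt_card (Finset.ssubset_iff_of_subset ?_ |>.2 ⟨k, by simp, ?_⟩)
    · intro i hi
      simp only [Finset.mem_filter, Finset.mem_univ, true_and, Finset.mem_Ici]
      by_cases hi' : i = p ∨ i = q
      · have := (htop i).2 hi'
        rw [Fin.le_def]
        omega
      · have hik : i < k := by
          simp only [B, Finset.mem_insert, Finset.mem_erase, Finset.mem_Iio] at hi
          tauto
        by_contra! hlt
        exact hkn (hasc i k hik hlt)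
    · simp only [B, Finset.mem_insert, Finset.mem_erase, Finset.mem_Iio, lt_irrefl]
      tauto
  rw [Fin.card_Ioi] at hlow
  rw [Fin.card_Ici] at hup
  simp only [topWord, topWordVal, ← Fin.ext_iff, if_neg hk]
  have := (π k).isLt
  omega

lemma injOn_topWord {n : ℕ} (hn : 1 ≤ n) : Set.InjOn (topWord n hn) (topPositions n) := by
  rintro ⟨p, q⟩ ⟨hpq, hq, -⟩ ⟨p', q'⟩ ⟨hpq', hq', -⟩ h
  dsimp only at hpq hq hpq' hq'
  have key : ∀ k < 2 * n, (k = p ∨ k = q) ↔ (k = p' ∨ k = q') := fun k hk => by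
    rw [← topWordVal_eq_top_iff hpq hq hk, ← topWordVal_eq_top_iff hpq' hq' hk]
    have : topWordVal n p q k = topWordVal n p' q' k := Fin.ext_iff.1 (congrFun h ⟨k, hk⟩)
    rw [this]
  have h₁ := key p (by omega)
  have h₂ := key q hq
  have h₃ := key p' (by omega)
  rw [Prod.mk.injEq]
  omega

lemma two_mul_ncard_topPositions {n : ℕ} (hn : 1 ≤ n) :
    2 * (topPositions n).ncard = n ^ 2 + 3 * n - 2 := by
  let s := ((Finset.range n).sigma fun b => Finset.range (b + 1)).image
    fun x => ((2 * x.2, 2 * x.1 + 1) : ℕ × ℕ)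
  let t := (Finset.range (n - 1)).image fun a => ((2 * a + 1, 2 * a + 2) : ℕ × ℕ)
  have hst : topPositions n = ↑(s ∪ t) := by
    ext ⟨p, q⟩
    simp only [topPositions, s, t, Set.mem_ofPred_eq, Finset.coe_union, Set.mem_union,
      Finset.mem_coe, Finset.mem_image, Finset.mem_sigma, Finset.mem_range, Prod.mk.injEq,
      Sigma.exists]
    constructor
    · intro h
      by_cases hp : p % 2 = 0
      · exact Or.inl ⟨q / 2, p / 2, by omega⟩
      · exact Or.inr ⟨p / 2, by omega⟩
    · rintro (⟨b, a, h⟩ | ⟨a, h⟩) <;> omega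
  have hdisj : Disjoint s t := by
    simp only [s, t, Finset.disjoint_left, Finset.mem_image, not_exists, not_and]
    rintro _ ⟨x, -, rfl⟩ a - h
    rw [Prod.mk.injEq] at h
    omega
  have hs : s.card = ∑ b ∈ Finset.range n, (b + 1) := by
    rw [Finset.card_image_of_injective, Finset.card_sigma]
    · simp
    · rintro ⟨b, a⟩ ⟨b', a'⟩ h
      simp only [Prod.mk.injEq] at h
      obtain rfl : a = a' := by omega
      obtain rfl : b = b' := by omega
      rfl
  have ht : t.card = n - 1 := by
    rw [Finset.card_image_of_injective, Finset.card_range]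
    intro a a' h
    simp only [Prod.mk.injEq] at h
    omega
  have hsum : 2 * ∑ b ∈ Finset.range n, (b + 1) = n ^ 2 + n := by
    clear * -
    induction n with
    | zero => rfl
    | succ n ih => rw [Finset.sum_range_succ, mul_add, ih]; ring
  rw [hst, Set.ncard_coe_finset, Finset.card_union_of_disjoint hdisj, hs, ht, mul_add, hsum]
  omega

theorem quasiStirling_avoiding_123_132_312 (n : ℕ) (hn : 1 ≤ n) :
    2 * Nat.card {π : Fin (2 * n) → Fin n //
      IsQuasiStirling n π ∧ Avoids3 n ![1, 2, 3] π ∧ Avoids3 n ![1, 3, 2] π ∧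
        Avoids3 n ![3, 1, 2] π} = n ^ 2 + 3 * n - 2 := by
  rw [← two_mul_ncard_topPositions hn, ← (injOn_topWord hn).ncard_image]
  congr 2
  have htop : ∀ π, IsMultisetPerm n π → ∃ m, (π m : ℕ) = n - 1 := fun π hπ => by
    obtain ⟨a, b, -, h⟩ := Set.ncard_eq_two.1 (hπ ⟨n - 1, by omega⟩)
    have ha : a ∈ {i | π i = ⟨n - 1, by omega⟩} := h ▸ Set.mem_insert a {b}
    exact ⟨a, Fin.ext_iff.1 ha⟩
  have himage : {π : Fin (2 * n) → Fin n |
      IsQuasiStirling n π ∧ Avoids3 n ![1, 2, 3] π ∧ Avoids3 n ![1, 3, 2] π ∧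
        Avoids3 n ![3, 1, 2] π} = topWord n hn '' topPositions n := by
    ext π
    constructor
    · rintro ⟨hπ, hav⟩
      obtain ⟨p, q, hpq, hq, rfl⟩ :=
        eq_topWord hn hπ.1 ((avoids_iff_ascentsToTop (htop π hπ.1)).1 hav)
      exact ⟨(p, q), mem_topPositions_of_isQuasiStirling hn hpq hq hπ, rfl⟩
    · rintro ⟨x, hx, rfl⟩
      have hq := isQuasiStirling_topWord hn hx
      exact ⟨hq, (avoids_iff_ascentsToTop (htop _ hq.1)).2 (ascentsToTop_topWord hn hx.1)⟩
  rw [← himage]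
  rfl
end

section
/- For every n ≥ 5, the numbers of quasi-Stirling permutations of the multiset [n,n] that avoid all patterns in {123, 132, 213, 321}, in {123, 132, 231, 321}, and in {123, 132, 312, 321}, respectively, are all 0. -/
/-- The smallest nontrivial case of the Erdős–Szekeres theorem: an injective sequence of five
elements of a linear order has a monotone subsequence of length three. -/
theorem exists_monotone_triple_of_injective {α : Type*} [LinearOrder α] (p : Fin 5 → α)
    (hp : Function.Injective p) :
    ∃ a b c : Fin 5, a < b ∧ b < c ∧
      ((p a < p b ∧ p b < p c) ∨ (p c < p b ∧ p b < p a)) := by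
  by_contra! h
  have key (a b c : Fin 5) (hab : a < b) (hbc : b < c) : p a < p b ↔ p c < p b := by
    have h₁ := hp.ne hab.ne
    have h₂ := hp.ne hbc.ne
    obtain ⟨h₃, h₄⟩ := h a b c hab hbc
    exact ⟨fun hlt => (h₃ hlt).lt_of_ne h₂.symm,
      fun hlt => (h₄ hlt).lt_of_ne h₁⟩
  have h014 := key 0 1 4 (by decide) (by decide)
  have h123 := key 1 2 3 (by decide) (by decide)
  have h134 := key 1 3 4 (by decide) (by decide)
  have h234 := key 2 3 4 (by decide) (by decide)
  grind

/-- Every value occurs in a permutation of the multiset `{1,1,2,2,…,n,n}`. -/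
theorem IsMultisetPerm.surjective {n : ℕ} {π : Fin (2 * n) → Fin n} (h : IsMultisetPerm n π) :
    Function.Surjective π := fun v => by
  have : Nonempty {i : Fin (2 * n) // π i = v} :=
    (Nat.card_pos_iff.1 (by rw [h v]; decide)).1
  exact ⟨_, this.some.2⟩

/-- For `n ≥ 5`, no permutation of `{1,1,2,2,…,n,n}` avoids both 123 and 321. -/
theorem IsMultisetPerm.not_avoids_123_and_321 {n : ℕ} (hn : 5 ≤ n) {π : Fin (2 * n) → Fin n}
    (h : IsMultisetPerm n π) (h123 : Avoids3 n ![1, 2, 3] π) : ¬ Avoids3 n ![3, 2, 1] π := by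
  intro h321
  obtain ⟨q, hq⟩ := h.surjective.hasRightInverse
  obtain ⟨a, b, c, hab, hbc, hmono⟩ := exists_monotone_triple_of_injective
    (q ∘ Fin.castLE hn) (hq.injective.comp (Fin.castLE_injective hn))
  rcases hmono with ⟨h₁, h₂⟩ | ⟨h₁, h₂⟩
  · refine h123 ⟨![q (Fin.castLE hn a), q (Fin.castLE hn b), q (Fin.castLE hn c)], ?_, ?_⟩
    · rw [Fin.strictMono_iff_lt_succ]
      intro i
      fin_cases i <;> assumption
    · intro x y
      fin_cases x <;> fin_cases y <;> simp [hq _] <;> order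
  · refine h321 ⟨![q (Fin.castLE hn c), q (Fin.castLE hn b), q (Fin.castLE hn a)], ?_, ?_⟩
    · rw [Fin.strictMono_iff_lt_succ]
      intro i
      fin_cases i <;> assumption
    · intro x y
      fin_cases x <;> fin_cases y <;> simp [hq _] <;> order

theorem quasiStirling_avoiding_four_patterns_with_123_321 (n : ℕ) (hn : 5 ≤ n) :
    Nat.card {π : Fin (2 * n) → Fin n //
        IsQuasiStirling n π ∧ Avoids3 n ![1, 2, 3] π ∧ Avoids3 n ![1, 3, 2] π ∧
          Avoids3 n ![2, 1, 3] π ∧ Avoids3 n ![3, 2, 1] π} = 0 ∧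
    Nat.card {π : Fin (2 * n) → Fin n //
        IsQuasiStirling n π ∧ Avoids3 n ![1, 2, 3] π ∧ Avoids3 n ![1, 3, 2] π ∧
          Avoids3 n ![2, 3, 1] π ∧ Avoids3 n ![3, 2, 1] π} = 0 ∧
    Nat.card {π : Fin (2 * n) → Fin n //
        IsQuasiStirling n π ∧ Avoids3 n ![1, 2, 3] π ∧ Avoids3 n ![1, 3, 2] π ∧
          Avoids3 n ![3, 1, 2] π ∧ Avoids3 n ![3, 2, 1] π} = 0 := by
  refine ⟨?_, ?_, ?_⟩ <;>
    exact Nat.card_eq_zero.2 <| Or.inl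
      ⟨fun ⟨_, hπ, h123, _, _, h321⟩ => hπ.1.not_avoids_123_and_321 hn h123 h321⟩
end

section
/- For every n ≥ 1 and every k with 1 ≤ k ≤ n, the number N of quasi-Stirling permutations of the multiset [n,n] with exactly k plateaus satisfies k · N = n! · C(n−1, k−1) · C(n, k−1), where C(a,b) denotes the binomial coefficient (equivalently, N = (n!/k) · C(n−1,k−1) · C(n,k−1)). -/
/-- The number of plateaus of `π`: indices `i` with `π i = π (i+1)`. -/
noncomputable def numPlateaus (n : ℕ) (π : Fin (2 * n) → Fin n) : ℕ :=
  Nat.card {i : Fin (2 * n) // ∃ h : (i : ℕ) + 1 < 2 * n, π i = π ⟨(i : ℕ) + 1, h⟩}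

namespace QuasiStirling

variable {α : Type*} [DecidableEq α]

/-- The number of adjacent equal pairs in a word. -/
def plateaus : List α → ℕ
  | [] => 0
  | [_] => 0
  | a :: b :: l => (if a = b then 1 else 0) + plateaus (b :: l)

/-- The words of length `L` that complete a prefix of a quasi-Stirling word, when the letters seen
once so far are stacked in `s`, most recent first, and the letters not seen yet are those of `U`:
each step either opens a new letter of `U` or closes the top letter of the stack. -/
def words : ℕ → List α → Finset α → Finset (List α)
  | 0, s, U => if s = [] ∧ U = ∅ then {[]} else ∅
  | L + 1, s, U =>
    (U.biUnion fun x => (words L (x :: s) (U.erase x)).image (List.cons x)) ∪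
      (match s with
        | [] => ∅
        | t :: s' => (words L s' U).image (List.cons t))

/-- The intrinsic description of `words`. -/
def Completes (s : List α) (U : Finset α) (w : List α) : Prop :=
  (∀ x, w.count x = if x ∈ U then 2 else if x ∈ s then 1 else 0) ∧
    ∀ a b, a ≠ b → ¬ [a, b, a, b].Sublist (s.reverse ++ w)

lemma plateaus_cons_of_notMem {x : α} {w : List α} (h : x ∉ w) :
    plateaus (x :: w) = plateaus w := by
  cases w with
  | nil => rfl
  | cons b l =>
    have : x ≠ b := fun e => h (by simp [e])
    simp [plateaus, this]

lemma nil_notMem_words_succ (L : ℕ) (s : List α) (U : Finset α) : [] ∉ words (L + 1) s U := by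
  cases s <;> simp [words]

lemma cons_mem_words_succ {L : ℕ} {s : List α} {U : Finset α} {x : α} {w : List α} :
    x :: w ∈ words (L + 1) s U ↔
      (x ∈ U ∧ w ∈ words L (x :: s) (U.erase x)) ∨ ∃ s', s = x :: s' ∧ w ∈ words L s' U := by
  cases s with
  | nil => simp [words]
  | cons t s =>
    simp only [words, Finset.mem_union, Finset.mem_biUnion, Finset.mem_image, List.cons.injEq]
    grind

lemma mem_of_mem_words {L : ℕ} {s : List α} {U : Finset α} {w : List α} (hw : w ∈ words L s U)
    {x : α} (hx : x ∈ w) : x ∈ s ∨ x ∈ U := by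
  induction L generalizing s U w with
  | zero =>
    simp only [words] at hw
    split_ifs at hw <;> simp_all
  | succ L ih =>
    cases w with
    | nil => simp at hx
    | cons y w =>
      rcases cons_mem_words_succ.1 hw with ⟨hy, hw'⟩ | ⟨s', rfl, hw'⟩ <;>
        rcases List.mem_cons.1 hx with rfl | hx
      · exact Or.inr hy
      · have := ih hw' hx
        grind
      · simp
      · have := ih hw' hx
        grind

lemma avoids_insert_pair {l₁ l₂ : List α} {x : α} (h₁ : x ∉ l₁) (h₂ : x ∉ l₂)
    (h : ∀ a b, a ≠ b → ¬ [a, b, a, b].Sublist (l₁ ++ l₂)) (a b : α) (hab : a ≠ b) :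
    ¬ [a, b, a, b].Sublist (l₁ ++ x :: x :: l₂) := by
  intro hs
  by_cases hx : a = x ∨ b = x
  · have key : ∀ y, y ≠ x → ¬ [x, y, x].Sublist (l₁ ++ x :: x :: l₂) := by
      intro y hy hs
      obtain ⟨u, v, huv, hu, hv⟩ := List.sublist_append_iff.1 hs
      cases u with
      | nil =>
        simp only [List.nil_append] at huv
        subst huv
        rw [List.cons_sublist_cons] at hv
        cases hv with
        | cons _ hv => exact h₂ (hv.subset (by simp))
        | cons_cons _ _ => exact hy rfl
      | cons c u =>
        simp only [List.cons_append, List.cons.injEq] at huv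
        exact h₁ (huv.1 ▸ hu.subset (by simp))
    rcases hx with rfl | rfl
    · exact key b hab.symm (List.Sublist.trans (by simp) hs)
    · exact key a hab (List.Sublist.trans (List.sublist_cons_self _ _) hs)
  · push Not at hx
    have := hs.filter (fun y => decide (y ≠ x))
    have e₁ : l₁.filter (fun y => decide (y ≠ x)) = l₁ := by
      rw [List.filter_eq_self]; intro y hy; simpa using fun e : y = x => h₁ (e ▸ hy)
    have e₂ : l₂.filter (fun y => decide (y ≠ x)) = l₂ := by
      rw [List.filter_eq_self]; intro y hy; simpa using fun e : y = x => h₂ (e ▸ hy)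
    have e₃ : (x :: x :: l₂).filter (fun y => decide (y ≠ x)) = l₂ := by
      rw [List.filter_cons_of_neg (by simp), List.filter_cons_of_neg (by simp), e₂]
    rw [List.filter_append, e₁, e₃] at this
    refine h a b hab ?_
    simpa [List.filter_cons, hx.1, hx.2] using this

lemma completes_cons_iff {s : List α} {U : Finset α} {x : α} {w : List α} (hs : s.Nodup)
    (hU : ∀ x ∈ s, x ∉ U) :
    Completes s U (x :: w) ↔ (x ∈ U ∧ Completes (x :: s) (U.erase x) w) ∨
      ∃ s', s = x :: s' ∧ Completes s' U w := by
  constructor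
  · rintro ⟨hc, ha⟩
    by_cases hx : x ∈ U
    · refine Or.inl ⟨hx, fun y => ?_, by simpa using ha⟩
      have := hc y
      have := hU y
      grind
    · right
      have hxs : x ∈ s := by
        have := hc x
        by_contra hxs
        simp [hx, hxs] at this
      cases s with
      | nil => simp at hxs
      | cons t s =>
        have htx : x = t := by
          by_contra hne
          have hxs' : x ∈ s := by grind
          have htw : t ∈ w := by
            have := hc t
            have := hU t (by simp)
            rw [← List.count_pos_iff]
            grind
          refine ha x t hne ?_
          have h1 : [x].Sublist s.reverse := by simpa using hxs'
          have h2 : [t].Sublist w := by simpa using htw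
          simpa using (h1.append (List.Sublist.refl [t])).append (h2.cons_cons x)
        subst htx
        refine ⟨s, rfl, fun y => ?_, fun a b hab hsub => ha a b hab (hsub.trans ?_)⟩
        · have := hc y
          have := hU y
          grind
        · simp only [List.reverse_cons, List.append_assoc]
          exact (List.Sublist.refl _).append (by simp)
  · rintro (⟨hx, hc, ha⟩ | ⟨s', rfl, hc, ha⟩)
    · refine ⟨fun y => ?_, by simpa using ha⟩
      have := hc y
      have := hU y
      grind
    · have hxU := hU x (by simp)
      have hxs : x ∉ s' := by grind
      refine ⟨fun y => ?_, ?_⟩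
      · have := hc y
        grind
      · have hxw : x ∉ w := by
          rw [← List.count_eq_zero, hc]
          simp [hxU, hxs]
        simpa using avoids_insert_pair (by simpa using hxs) hxw ha

theorem mem_words_iff {L : ℕ} {s : List α} {U : Finset α} {w : List α} (hs : s.Nodup)
    (hU : ∀ x ∈ s, x ∉ U) : w ∈ words L s U ↔ w.length = L ∧ Completes s U w := by
  induction L generalizing s U w with
  | zero =>
    simp only [words, List.length_eq_zero_iff]
    constructor
    · split_ifs with h
      · rintro hw
        obtain rfl : w = [] := by simpa using hw
        refine ⟨rfl, by simp [h], by simp [h]⟩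
      · simp
    · rintro ⟨rfl, hc, -⟩
      have h1 : U = ∅ := by
        ext x
        have := hc x
        simp only [List.count_nil] at this
        grind
      have h2 : s = [] := by
        rw [List.eq_nil_iff_forall_not_mem]
        intro x
        have := hc x
        simp only [List.count_nil] at this
        grind
      simp [h1, h2]
  | succ L ih =>
    cases w with
    | nil => simp [nil_notMem_words_succ]
    | cons x w =>
      rw [cons_mem_words_succ, completes_cons_iff hs hU, List.length_cons, Nat.add_right_cancel_iff,
        and_or_left]
      refine or_congr ?_ ?_
      · rw [and_left_comm]
        refine and_congr_right fun hx => ih ?_ ?_ <;> grind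
      · constructor
        · rintro ⟨s', rfl, hw⟩
          have := (ih (by grind) (by grind)).1 hw
          exact ⟨this.1, s', rfl, this.2⟩
        · rintro ⟨hl, s', rfl, hw⟩
          exact ⟨s', rfl, (ih (by grind) (by grind)).2 ⟨hl, hw⟩⟩

lemma card_filter_image_cons (S : Finset (List α)) (x : α) (P : List α → Prop)
    [DecidablePred P] :
    ((S.image (List.cons x)).filter P).card = (S.filter fun w => P (x :: w)).card := by
  rw [Finset.filter_image, Finset.card_image_of_injective _ List.cons_injective]

lemma card_filter_opened (L : ℕ) (s : List α) (U : Finset α) (P : List α → Prop)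
    [DecidablePred P] :
    ((U.biUnion fun x => (words L (x :: s) (U.erase x)).image (List.cons x)).filter P).card =
      ∑ x ∈ U, ((words L (x :: s) (U.erase x)).filter fun w => P (x :: w)).card := by
  rw [Finset.filter_biUnion, Finset.card_biUnion]
  · simp_rw [card_filter_image_cons]
  · intro x _ y _ hxy
    rw [Function.onFun, Finset.disjoint_left]
    intro w hw hw'
    simp only [Finset.mem_filter, Finset.mem_image] at hw hw'
    grind

lemma card_filter_words_nil (L : ℕ) (U : Finset α) (P : List α → Prop) [DecidablePred P] :
    ((words (L + 1) [] U).filter P).card =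
      ∑ x ∈ U, ((words L [x] (U.erase x)).filter fun w => P (x :: w)).card := by
  rw [← card_filter_opened]
  simp [words]

lemma card_filter_words_cons (L : ℕ) {t : α} (s : List α) {U : Finset α} (ht : t ∉ U)
    (P : List α → Prop) [DecidablePred P] :
    ((words (L + 1) (t :: s) U).filter P).card =
      ∑ x ∈ U, ((words L (x :: t :: s) (U.erase x)).filter fun w => P (x :: w)).card +
        ((words L s U).filter fun w => P (t :: w)).card := by
  rw [← card_filter_opened, ← card_filter_image_cons, ← Finset.card_union_of_disjoint,
    ← Finset.filter_union]
  · rfl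
  · rw [Finset.disjoint_left]
    intro w hw hw'
    simp only [Finset.mem_filter, Finset.mem_image, Finset.mem_biUnion] at hw hw'
    grind

/-- The number of lattice paths with `m` up steps, from height `h` to height `0`, staying
nonnegative and having `k` peaks. -/
def pathCount (h m k : ℕ) : ℤ :=
  m.choose k * (m + h).choose k - match m with
    | 0 => 0
    | m + 1 => m.choose k * (m + h + 2).choose k

/-- As `pathCount`, from height `h + 1` and with a preceding up step that may form a peak. -/
def pathCountAfterUp (h m : ℕ) : ℕ → ℤ
  | 0 => 0
  | k + 1 => (m + 1).choose (k + 1) * (m + h).choose k - m.choose (k + 1) * (m + h + 1).choose k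

lemma pathCount_zero_zero (k : ℕ) : pathCount 0 0 k = if k = 0 then 1 else 0 := by
  cases k <;> simp [pathCount]

lemma pathCount_zero_succ (m k : ℕ) : pathCount 0 (m + 1) k = pathCountAfterUp 0 m k := by
  cases k with
  | zero => simp [pathCount, pathCountAfterUp]
  | succ k =>
    have h1 := Nat.choose_succ_succ' m k
    have h2 := Nat.choose_succ_succ' (m + 1) k
    simp only [pathCount, pathCountAfterUp, add_zero]
    rw [h2]
    push_cast [h1]
    ring

lemma pathCount_succ_zero (h k : ℕ) : pathCount (h + 1) 0 k = pathCount h 0 k := by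
  cases k <;> simp [pathCount]

lemma pathCount_succ_succ (h m k : ℕ) :
    pathCount (h + 1) (m + 1) k = pathCountAfterUp (h + 1) m k + pathCount h (m + 1) k := by
  cases k with
  | zero => simp [pathCount, pathCountAfterUp]
  | succ k =>
    have h2 := Nat.choose_succ_succ' (m + h + 1) k
    have h3 := Nat.choose_succ_succ' (m + h + 2) k
    zify at h2 h3
    simp only [pathCount, pathCountAfterUp]
    rw [show m + 1 + (h + 1) = m + h + 1 + 1 by ring, show m + (h + 1) + 2 = m + h + 2 + 1 by ring,
      show m + (h + 1) = m + h + 1 by ring, show m + 1 + h = m + h + 1 by ring]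
    linear_combination ((m + 1).choose (k + 1) : ℤ) * h2 - (m.choose (k + 1) : ℤ) * h3

lemma pathCountAfterUp_succ_zero (h k : ℕ) :
    pathCountAfterUp h 0 (k + 1) = pathCount h 0 k := by
  cases k <;> simp [pathCount, pathCountAfterUp, Nat.choose_eq_zero_of_lt]

lemma pathCountAfterUp_succ_succ (h m k : ℕ) :
    pathCountAfterUp h (m + 1) (k + 1) =
      pathCountAfterUp (h + 1) m (k + 1) + pathCount h (m + 1) k := by
  have h2 := Nat.choose_succ_succ' (m + 1) k
  have h3 := Nat.choose_succ_succ' m k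
  simp only [pathCount, pathCountAfterUp]
  rw [show m + 1 + h = m + h + 1 by ring, show m + (h + 1) = m + h + 1 by ring, h2]
  push_cast [h3]
  ring

theorem card_words (L : ℕ) : ∀ (s : List α) (U : Finset α), s.Nodup → (∀ x ∈ s, x ∉ U) →
    L = s.length + 2 * U.card → ∀ k,
    ((((words L s U).filter fun w => plateaus w = k).card : ℤ) =
      U.card.factorial * pathCount s.length U.card k) ∧
    ∀ t s', s = t :: s' → (((words L s U).filter fun w => plateaus (t :: w) = k).card : ℤ) =
      U.card.factorial * pathCountAfterUp s'.length U.card k := by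
  induction L with
  | zero =>
    intro s U _ _ hL k
    obtain rfl : s = [] := List.length_eq_zero_iff.1 (by omega)
    obtain rfl : U = ∅ := Finset.card_eq_zero.1 (by omega)
    refine ⟨?_, by simp⟩
    rcases eq_or_ne k 0 with rfl | hk
    · simp [words, pathCount_zero_zero, Finset.filter_singleton, plateaus]
    · simp [words, pathCount_zero_zero, Finset.filter_singleton, plateaus, hk, hk.symm]
  | succ L ih =>
    intro s U hs hU hL k
    have opened : ∀ j, ∑ x ∈ U,
        (((words L (x :: s) (U.erase x)).filter fun w => plateaus (x :: w) = j).card : ℤ) =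
        match U.card with
        | 0 => 0
        | m + 1 => (m + 1).factorial * pathCountAfterUp s.length m j := by
      intro j
      rcases hm : U.card with _ | m
      · simp [Finset.card_eq_zero.1 hm]
      · rw [Finset.sum_congr rfl fun x hx => (ih (x :: s) (U.erase x) (by grind) (by grind)
          (by rw [Finset.card_erase_of_mem hx, List.length_cons]; omega) j).2 x s rfl]
        rw [Finset.sum_congr rfl fun x hx => by rw [Finset.card_erase_of_mem hx, hm]]
        simp only [Finset.sum_const, hm, Nat.factorial_succ, nsmul_eq_mul, Nat.add_sub_cancel]
        push_cast
        ring
    cases s with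
    | nil =>
      refine ⟨?_, by simp⟩
      rw [card_filter_words_nil]
      push_cast
      rw [opened]
      rcases hm : U.card with _ | m
      · simp [hm] at hL
      · simp [pathCount_zero_succ]
    | cons t s =>
      have htU := hU t (by simp)
      have hts : t ∉ s := by grind
      have notMem : ∀ w ∈ words L s U, t ∉ w := fun w hw ht => by
        have := mem_of_mem_words hw ht
        grind
      have closed := ih s U (by grind) (by grind) (by simp at hL; omega)
      refine ⟨?_, ?_⟩
      · rw [card_filter_words_cons L s htU]
        push_cast
        rw [opened, Finset.filter_congr fun w hw => by
          rw [plateaus_cons_of_notMem (notMem w hw)], (closed k).1]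
        rcases hm : U.card with _ | m
        · simp [pathCount_succ_zero]
        · simp [pathCount_succ_succ, mul_add]
      · rintro t' s' ⟨⟩
        rw [card_filter_words_cons L s htU, Finset.filter_congr (s := words L s U) fun w hw => by
          rw [plateaus, plateaus_cons_of_notMem (notMem w hw), if_pos rfl]]
        rw [Finset.sum_congr rfl fun x hx => by
          rw [Finset.filter_congr fun w hw => by
            rw [plateaus, if_neg (fun e : t = x => htU (e ▸ hx)), zero_add]]]
        push_cast
        rw [opened]
        cases k with
        | zero => rcases hm : U.card with _ | m <;> simp [pathCountAfterUp]
        | succ k =>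
          simp only [add_comm 1, Nat.add_right_cancel_iff]
          rw [(closed k).1]
          rcases hm : U.card with _ | m
          · simp [pathCountAfterUp_succ_zero]
          · simp [pathCountAfterUp_succ_succ, mul_add]

lemma succ_mul_pathCountAfterUp (m j : ℕ) :
    ((j : ℤ) + 1) * pathCountAfterUp 0 m (j + 1) = m.choose j * (m + 1).choose j := by
  have h1 : ((m + 1 : ℕ) : ℤ) * m.choose j = (m + 1).choose (j + 1) * (j + 1 : ℕ) := by
    exact_mod_cast Nat.add_one_mul_choose_eq m j
  have h2 : ((m + 1).choose (j + 1) : ℤ) = m.choose j + m.choose (j + 1) := by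
    exact_mod_cast Nat.choose_succ_succ' m j
  have h3 : ((m + 1 : ℕ) : ℤ) * m.choose j = (m + 1).choose j * (m + 1 - j) := by
    rcases le_or_gt j (m + 1) with h | h
    · have := Nat.add_one_mul_choose_eq m j
      have h4 := Nat.choose_succ_right_eq (m + 1) j
      zify [h] at this h4
      push_cast at *
      linarith
    · simp [Nat.choose_eq_zero_of_lt h, Nat.choose_eq_zero_of_lt (show m < j by omega)]
  push_cast at h1 h3
  simp only [pathCountAfterUp, add_zero]
  linear_combination (-(m.choose j : ℤ) + (m + 1).choose j) * h1 +
    (j + 1) * (m + 1).choose j * h2 + m.choose j * h3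

lemma plateaus_eq_card (l : List α) :
    plateaus l = ((Finset.range (l.length - 1)).filter fun i => l[i]? = l[i + 1]?).card := by
  induction l with
  | nil => rfl
  | cons a l ih =>
    cases l with
    | nil => rfl
    | cons b l =>
      rw [plateaus, ih, Finset.card_filter, Finset.card_filter]
      simp only [List.length_cons, Nat.add_sub_cancel]
      rw [Finset.sum_range_succ', add_comm]
      simp

lemma numPlateaus_eq {n : ℕ} (π : Fin (2 * n) → Fin n) :
    numPlateaus n π = plateaus (List.ofFn π) := by
  rw [plateaus_eq_card, numPlateaus, ← Nat.card_eq_finsetCard]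
  refine Nat.card_eq_of_bijective (fun i => ⟨i.1.1, ?_⟩) ⟨?_, ?_⟩
  · obtain ⟨i, h, hi⟩ := i
    simp only [Finset.mem_filter, Finset.mem_range, List.length_ofFn]
    refine ⟨by omega, ?_⟩
    simpa [h] using hi
  · rintro ⟨i, hi⟩ ⟨j, hj⟩ h
    exact Subtype.ext (Fin.ext (congrArg Subtype.val h))
  · rintro ⟨i, hi⟩
    simp only [Finset.mem_filter, Finset.mem_range, List.length_ofFn] at hi
    have h : i + 1 < 2 * n := by omega
    refine ⟨⟨⟨i, by omega⟩, h, ?_⟩, rfl⟩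
    simpa [h, show i < 2 * n by omega] using hi.2

lemma count_ofFn {m : ℕ} (f : Fin m → α) (v : α) :
    (List.ofFn f).count v = Nat.card {i // f i = v} := by
  rw [Nat.card_eq_fintype_card, Fintype.card_subtype, Finset.card_filter]
  induction m with
  | zero => simp
  | succ m ih =>
    rw [List.ofFn_succ, List.count_cons, Fin.sum_univ_succ, ih, add_comm]
    simp

lemma isMultisetPerm_iff {n : ℕ} (π : Fin (2 * n) → Fin n) :
    IsMultisetPerm n π ↔ ∀ v, (List.ofFn π).count v = 2 := by
  simp only [IsMultisetPerm, count_ofFn]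

lemma sublist_ofFn_iff {β : Type*} {m : ℕ} (f : Fin m → β) (a b : β) :
    [a, b, a, b].Sublist (List.ofFn f) ↔ ∃ i j k l : Fin m, i < j ∧ j < k ∧ k < l ∧
      f i = a ∧ f j = b ∧ f k = a ∧ f l = b := by
  rw [List.sublist_iff_exists_fin_orderEmbedding_get_eq]
  constructor
  · rintro ⟨g, hg⟩
    have hlen : (List.ofFn f).length = m := List.length_ofFn
    refine ⟨(g 0).cast hlen, (g 1).cast hlen, (g 2).cast hlen, (g 3).cast hlen, ?_, ?_, ?_, ?_⟩
    · exact g.strictMono (by decide : (0 : Fin 4) < 1)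
    · exact g.strictMono (by decide : (1 : Fin 4) < 2)
    · exact g.strictMono (by decide : (2 : Fin 4) < 3)
    · have h0 := hg 0
      have h1 := hg 1
      have h2 := hg 2
      have h3 := hg 3
      simp only [List.get_ofFn] at h0 h1 h2 h3
      exact ⟨h0.symm, h1.symm, h2.symm, h3.symm⟩
  · rintro ⟨i, j, k, l, hij, hjk, hkl, rfl, rfl, hk, hl⟩
    have hlen : m = (List.ofFn f).length := List.length_ofFn.symm
    refine ⟨OrderEmbedding.ofStrictMono (fun x : Fin 4 => (![i, j, k, l] x).cast hlen) ?_, ?_⟩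
    · rw [Fin.strictMono_iff_lt_succ]
      intro x
      fin_cases x <;> simpa
    · intro x
      simp only [List.get_ofFn]
      change Fin 4 at x
      fin_cases x <;> simp [hk, hl]

lemma isQuasiStirling_iff {n : ℕ} (π : Fin (2 * n) → Fin n) :
    IsQuasiStirling n π ↔ Completes [] Finset.univ (List.ofFn π) := by
  simp only [IsQuasiStirling, isMultisetPerm_iff, Completes, Finset.mem_univ, if_true,
    List.reverse_nil, List.nil_append, sublist_ofFn_iff]
  refine and_congr_right fun _ => ?_
  constructor
  · rintro ⟨h1, h2⟩ a b hab ⟨i, j, k, l, hij, hjk, hkl, rfl, rfl, hk, hl⟩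
    rcases lt_or_gt_of_ne hab with h | h
    · exact h1 ⟨i, j, k, l, hij, hjk, hkl, hk.symm, hl.symm, h⟩
    · exact h2 ⟨i, j, k, l, hij, hjk, hkl, hk.symm, hl.symm, h⟩
  · intro h
    constructor <;> rintro ⟨i, j, k, l, hij, hjk, hkl, hk, hl, hlt⟩
    · exact h _ _ hlt.ne ⟨i, j, k, l, hij, hjk, hkl, rfl, rfl, hk.symm, hl.symm⟩
    · exact h _ _ hlt.ne' ⟨i, j, k, l, hij, hjk, hkl, rfl, rfl, hk.symm, hl.symm⟩

lemma card_quasiStirling (n k : ℕ) :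
    Nat.card {π : Fin (2 * n) → Fin n // IsQuasiStirling n π ∧ numPlateaus n π = k} =
      ((words (2 * n) [] (Finset.univ : Finset (Fin n))).filter fun w => plateaus w = k).card := by
  rw [← Nat.card_eq_finsetCard]
  have hmem : ∀ w : List (Fin n), w ∈ words (2 * n) [] (Finset.univ : Finset (Fin n)) ↔
      w.length = 2 * n ∧ Completes [] Finset.univ w := fun w => mem_words_iff (by simp) (by simp)
  refine Nat.card_eq_of_bijective
    (fun π => ⟨List.ofFn π.1, by
      simpa [hmem, ← isQuasiStirling_iff, ← numPlateaus_eq] using π.2⟩) ⟨?_, ?_⟩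
  · intro π ρ h
    exact Subtype.ext (List.ofFn_injective (congrArg Subtype.val h))
  · rintro ⟨w, hw⟩
    obtain ⟨hw, hk⟩ := Finset.mem_filter.1 hw
    obtain ⟨hl, hc⟩ := (hmem w).1 hw
    have hπ : List.ofFn (fun i : Fin (2 * n) => w.get (i.cast hl.symm)) = w := by
      apply List.ext_getElem <;> simp [hl]
    refine ⟨⟨fun i => w.get (i.cast hl.symm), ?_⟩, Subtype.ext hπ⟩
    rw [isQuasiStirling_iff, numPlateaus_eq, hπ]
    exact ⟨hc, hk⟩

end QuasiStirling

theorem quasiStirling_count_by_plateaus (n k : ℕ) (hn : 1 ≤ n)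
    (hk1 : 1 ≤ k) (hkn : k ≤ n) :
    k * Nat.card {π : Fin (2 * n) → Fin n //
        IsQuasiStirling n π ∧ numPlateaus n π = k} =
      Nat.factorial n * Nat.choose (n - 1) (k - 1) * Nat.choose n (k - 1) := by
  obtain ⟨m, rfl⟩ := Nat.exists_eq_add_of_le' hn
  obtain ⟨j, rfl⟩ := Nat.exists_eq_add_of_le' hk1
  have hcard := (QuasiStirling.card_words (2 * (m + 1)) []
    (Finset.univ : Finset (Fin (m + 1))) (by simp) (by simp) (by simp) (j + 1)).1
  rw [Finset.card_univ, Fintype.card_fin, List.length_nil,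
    QuasiStirling.pathCount_zero_succ] at hcard
  rw [QuasiStirling.card_quasiStirling]
  rw [← Nat.cast_inj (R := ℤ), Nat.cast_mul, hcard]
  simp only [Nat.add_sub_cancel]
  push_cast
  linear_combination ((m + 1).factorial : ℤ) * QuasiStirling.succ_mul_pathCountAfterUp m j
end
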